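/- Suppose the (k,p,q)-differential condition holds and that every closed two-sided *-ideal of A of finite codimension (as a linear subspace) possesses a bounded left approximate identity. Let X be a Banach A-bimodule and θ : A → X an A-intertwining operator, where A is regarded as a bimodule over itself via multiplication. Then θ is continuous. -/

import Mathlib

open Filter Topology MeasureTheory

set_option linter.unusedSectionVars false

/-- A power with a smaller exponent is dominated, up to a constant, by one with a larger
exponent. -/
lemma exists_rpow_le_rpow_add_const {γ η : ℝ} (hγ : 0 < γ) (hγη : γ < η) {b : ℝ} (hb : 0 < b)
    {c : ℝ} (hc : 0 ≤ c) : ∃ K : ℝ, ∀ u : ℝ, 0 ≤ u → c * u ^ γ ≤ (b * u) ^ η + K := by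
  have hT : Tendsto (fun u : ℝ => b ^ η * u ^ (η - γ)) atTop atTop :=
    (tendsto_rpow_atTop (sub_pos.2 hγη)).const_mul_atTop (Real.rpow_pos_of_pos hb η)
  obtain ⟨T, hT⟩ := (hT.eventually_ge_atTop c).exists_forall_of_atTop
  refine ⟨c * (max T 1) ^ γ, fun u hu => ?_⟩
  have h0 : 0 ≤ c * (max T 1) ^ γ := by positivity
  rcases le_total u (max T 1) with h | h
  · have : c * u ^ γ ≤ c * (max T 1) ^ γ := by gcongr
    have : 0 ≤ (b * u) ^ η := by positivity
    linarith
  · have hu0 : 0 < u := lt_of_lt_of_le (by positivity) h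
    have h1 := hT u (le_trans (le_max_left _ _) h)
    have h2 : (b * u) ^ η = b ^ η * u ^ (η - γ) * u ^ γ := by
      rw [Real.mul_rpow hb.le hu, mul_assoc, ← Real.rpow_add hu0]; simp
    have : c * u ^ γ ≤ b ^ η * u ^ (η - γ) * u ^ γ := by gcongr
    linarith

/-- Superpolynomial decay of products of cardinal sines with widths `δ / (i + 1) ^ s`. -/
lemma exists_prod_sinc_mul_exp_le {s δ γ : ℝ} (hs : 1 < s) (hδ : 0 < δ) (hγ : 0 < γ)
    (hγs : γ < 1 / s) (c : ℝ) :
    ∃ K : ℝ, ∀ t : ℝ, ∀ᶠ N : ℕ in atTop,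
      |∏ i ∈ Finset.range N, Real.sinc (2 * Real.pi * (δ / ((i : ℝ) + 1) ^ s) * t)| *
        Real.exp (c * |t| ^ γ) ≤ K := by
  set b : ℝ := 2 * Real.pi * δ / Real.exp 1 with hb
  have hb0 : 0 < b := by positivity
  have hs0 : 0 < s := by linarith
  obtain ⟨K, hK⟩ := exists_rpow_le_rpow_add_const hγ hγs hb0 (abs_nonneg c)
  refine ⟨Real.exp (1 + K), fun t => ?_⟩
  set n : ℕ := ⌊(b * |t|) ^ (1 / s)⌋₊ with hn
  filter_upwards [eventually_ge_atTop n] with N hN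
  have hfac : ∀ i ∈ Finset.range n,
      |Real.sinc (2 * Real.pi * (δ / ((i : ℝ) + 1) ^ s) * t)| ≤ Real.exp (-1) := by
    intro i hi
    have hi1 : ((i : ℝ) + 1) ≤ (b * |t|) ^ (1 / s) := by
      have : ((i + 1 : ℕ) : ℝ) ≤ n := by exact_mod_cast Finset.mem_range.1 hi
      push_cast at this
      exact this.trans (Nat.floor_le (by positivity))
    have hi2 : ((i : ℝ) + 1) ^ s ≤ b * |t| := by
      calc ((i : ℝ) + 1) ^ s ≤ ((b * |t|) ^ (1 / s)) ^ s := by gcongr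
        _ = b * |t| := by rw [← Real.rpow_mul (by positivity)]; field_simp; simp
    have hpos : 0 < ((i : ℝ) + 1) ^ s := by positivity
    have hx : Real.exp 1 ≤ |2 * Real.pi * (δ / ((i : ℝ) + 1) ^ s) * t| := by
      rw [abs_mul, abs_of_pos (by positivity : 0 < 2 * Real.pi * (δ / ((i : ℝ) + 1) ^ s))]
      have : 2 * Real.pi * (δ / ((i : ℝ) + 1) ^ s) * |t|
          = (Real.exp 1 * (b * |t|)) / ((i : ℝ) + 1) ^ s := by rw [hb]; field_simp
      rw [this, le_div_iff₀ hpos]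
      gcongr
    set x := 2 * Real.pi * (δ / ((i : ℝ) + 1) ^ s) * t
    have hx0 : x ≠ 0 := by
      rintro h; rw [h, abs_zero] at hx; exact absurd hx (not_le.2 (Real.exp_pos 1))
    rw [Real.sinc_of_ne_zero hx0, abs_div, Real.exp_neg]
    calc |Real.sin x| / |x| ≤ 1 / Real.exp 1 := by
          gcongr; exact Real.abs_sin_le_one x
      _ = _ := one_div _
  have hprod : |∏ i ∈ Finset.range N, Real.sinc (2 * Real.pi * (δ / ((i : ℝ) + 1) ^ s) * t)|
      ≤ Real.exp (-(n : ℝ)) := by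
    rw [Finset.abs_prod, ← Finset.prod_range_mul_prod_Ico _ hN]
    calc _ ≤ Real.exp (-1) ^ n * 1 := by
          gcongr
          · calc _ ≤ ∏ i ∈ Finset.range n, Real.exp (-1) :=
                Finset.prod_le_prod (fun _ _ => abs_nonneg _) hfac
              _ = _ := by simp
          · exact Finset.prod_le_one (fun _ _ => abs_nonneg _) fun _ _ => Real.abs_sinc_le_one _
      _ = _ := by rw [mul_one, ← Real.exp_nat_mul]; simp
  have hfl : (b * |t|) ^ (1 / s) ≤ n + 1 := (Nat.lt_floor_add_one _).le
  have hc : c * |t| ^ γ ≤ |c| * |t| ^ γ := by gcongr; exact le_abs_self c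
  have := hK |t| (abs_nonneg t)
  calc _ ≤ Real.exp (-(n : ℝ)) * Real.exp (c * |t| ^ γ) := by gcongr
    _ = Real.exp (-n + c * |t| ^ γ) := (Real.exp_add _ _).symm
    _ ≤ _ := Real.exp_le_exp.2 (by linarith)

lemma abs_sinc_sub_one_le (x : ℝ) : |Real.sinc x - 1| ≤ 2 * |x| := by
  rcases le_total 1 |x| with h | h
  · calc |Real.sinc x - 1| ≤ |Real.sinc x| + |(1 : ℝ)| := abs_sub _ _
      _ ≤ 2 * |x| := by rw [abs_one]; linarith [Real.abs_sinc_le_one x]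
  · rcases eq_or_ne x 0 with rfl | hx
    · simp
    have h1 := Real.sin_bound h
    have hx' : 0 < |x| := abs_pos.2 hx
    rw [Real.sinc_of_ne_zero hx, div_sub_one hx, abs_div, div_le_iff₀ hx']
    have h2 : |Real.sin x - x| ≤ |Real.sin x - (x - x ^ 3 / 6)| + |x| ^ 3 / 6 := by
      have : Real.sin x - x = (Real.sin x - (x - x ^ 3 / 6)) + (- (x ^ 3 / 6)) := by ring
      rw [this]
      refine (abs_add_le _ _).trans (le_of_eq ?_)
      rw [abs_neg, abs_div, abs_pow]; norm_num
    nlinarith [pow_le_pow_of_le_one (abs_nonneg x) h (show 2 ≤ 3 by norm_num),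
      pow_le_pow_of_le_one (abs_nonneg x) h (show 2 ≤ 4 by norm_num), sq_nonneg |x|]

/-- Multiplying a Fourier transform by a cardinal sine averages the function over an interval. -/
lemma integral_mul_sinc_mul_exp {g : ℝ → ℂ} (hg : Integrable g) {a : ℝ} (ha : 0 < a) (x : ℝ) :
    ∫ t : ℝ, (Real.sinc (2 * Real.pi * a * t) : ℂ) * g t *
        Complex.exp ((2 * Real.pi * t * x : ℝ) * Complex.I) =
      ((2 * a)⁻¹ : ℝ) * ∫ s in (-a)..a, ∫ t : ℝ, g t *
        Complex.exp ((2 * Real.pi * t * (x + s) : ℝ) * Complex.I) := by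
  have key : ∀ t : ℝ, ((2 * a)⁻¹ : ℝ) * ∫ s in (-a)..a,
      Complex.exp ((2 * Real.pi * t * s : ℝ) * Complex.I) = Real.sinc (2 * Real.pi * a * t) := by
    intro t
    rcases eq_or_ne t 0 with rfl | ht
    · have : (a : ℂ) ≠ 0 := by exact_mod_cast ha.ne'
      simp; field_simp; norm_num
    have hc : (2 * Real.pi * t * Complex.I : ℂ) ≠ 0 := by
      simp [ht, Real.pi_ne_zero]
    have h1 : ∫ s in (-a)..a, Complex.exp ((2 * Real.pi * t * s : ℝ) * Complex.I)
        = ∫ s in (-a)..a, Complex.exp ((2 * Real.pi * t * Complex.I) * s) := by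
      congr 1; ext s; push_cast; ring_nf
    have hx0 : 2 * Real.pi * a * t ≠ 0 := by positivity
    rw [h1, integral_exp_mul_complex hc, Real.sinc_of_ne_zero hx0]
    push_cast
    rw [Complex.sin]
    have : (a : ℂ) ≠ 0 := by exact_mod_cast ha.ne'
    have : (t : ℂ) ≠ 0 := by exact_mod_cast ht
    have : (Real.pi : ℂ) ≠ 0 := by exact_mod_cast Real.pi_ne_zero
    field_simp
    ring_nf
    simp only [Complex.I_sq]
    ring
  rw [intervalIntegral_integral_swap, ← integral_const_mul]
  · congr 1; ext t
    have : ∀ s : ℝ, g t * Complex.exp ((2 * Real.pi * t * (x + s) : ℝ) * Complex.I) =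
        g t * Complex.exp ((2 * Real.pi * t * x : ℝ) * Complex.I) *
          Complex.exp ((2 * Real.pi * t * s : ℝ) * Complex.I) := by
      intro s
      rw [mul_assoc (g t), ← Complex.exp_add]; push_cast; ring_nf
    simp_rw [this]
    rw [intervalIntegral.integral_const_mul, ← key]
    ring
  · have : IsFiniteMeasure (volume.restrict (Set.uIoc (-a) a)) := by
      rw [Set.uIoc]; infer_instance
    have h1 : Integrable (fun z : ℝ × ℝ => g z.2)
        ((volume.restrict (Set.uIoc (-a) a)).prod volume) := hg.comp_snd _
    refine h1.mul_bdd (c := 1) (Continuous.aestronglyMeasurable (by fun_prop)) ?_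
    exact Eventually.of_forall fun z => (Complex.norm_exp_ofReal_mul_I _).le

/-- Iterated averages of a function over the intervals `[x - a i, x + a i]`. -/
noncomputable def iteratedAverage (a : ℕ → ℝ) (f : ℝ → ℝ) : ℕ → ℝ → ℝ
  | 0 => f
  | N + 1 => fun x => (2 * a N)⁻¹ * ∫ s in (-a N)..(a N), iteratedAverage a f N (x + s)

lemma continuous_iteratedAverage (a : ℕ → ℝ) {f : ℝ → ℝ} (hf : Continuous f) (N : ℕ) :
    Continuous (iteratedAverage a f N) := by
  induction N with
  | zero => exact hf
  | succ N ih =>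
    refine continuous_const.mul ?_
    exact intervalIntegral.continuous_parametric_intervalIntegral_of_continuous'
      (f := fun x s => iteratedAverage a f N (x + s)) (by fun_prop) _ _

lemma le_inv_mul_integral {h : ℝ → ℝ} (hh : Continuous h) {a m : ℝ} (ha : 0 < a)
    (hm : ∀ s ∈ Set.Icc (-a) a, m ≤ h s) : m ≤ (2 * a)⁻¹ * ∫ s in (-a)..a, h s := by
  have := intervalIntegral.integral_mono_on (μ := volume) (by linarith : -a ≤ a)
    (f := fun _ => m) (by simp) (hh.intervalIntegrable _ _) hm
  rw [intervalIntegral.integral_const, smul_eq_mul] at this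
  rw [← div_eq_inv_mul, le_div_iff₀ (by positivity)]
  linarith

lemma inv_mul_integral_le {h : ℝ → ℝ} (hh : Continuous h) {a m : ℝ} (ha : 0 < a)
    (hm : ∀ s ∈ Set.Icc (-a) a, h s ≤ m) : (2 * a)⁻¹ * ∫ s in (-a)..a, h s ≤ m := by
  have := le_inv_mul_integral hh.neg ha (m := -m) fun s hs => neg_le_neg (hm s hs)
  simp only [Pi.neg_apply, intervalIntegral.integral_neg] at this
  linarith

lemma iteratedAverage_plateau {a : ℕ → ℝ} (ha : ∀ i, 0 < a i) {f : ℝ → ℝ} (hf : Continuous f)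
    {x₀ r R : ℝ} (h0 : ∀ x, 0 ≤ f x) (h1 : ∀ x, f x ≤ 1) (hr : ∀ x, |x - x₀| ≤ r → f x = 1)
    (hR : ∀ x, R ≤ |x - x₀| → f x = 0) (N : ℕ) :
    (∀ x, 0 ≤ iteratedAverage a f N x) ∧ (∀ x, iteratedAverage a f N x ≤ 1) ∧
    (∀ x, |x - x₀| ≤ r - ∑ i ∈ Finset.range N, a i → iteratedAverage a f N x = 1) ∧
    (∀ x, R + ∑ i ∈ Finset.range N, a i ≤ |x - x₀| → iteratedAverage a f N x = 0) := by
  induction N with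
  | zero => simpa [iteratedAverage] using ⟨h0, h1, hr, hR⟩
  | succ N ih =>
    obtain ⟨i0, i1, ir, iR⟩ := ih
    have hc : ∀ x, Continuous fun s => iteratedAverage a f N (x + s) := fun x =>
      (continuous_iteratedAverage a hf N).comp (by fun_prop)
    have hs : ∀ s ∈ Set.Icc (-a N) (a N), |s| ≤ a N := fun s hs => abs_le.2 hs
    have htri : ∀ x s : ℝ, |x + s - x₀| ≤ |x - x₀| + |s| ∧ |x - x₀| - |s| ≤ |x + s - x₀| := by
      intro x s
      have e : x + s - x₀ = (x - x₀) + s := by ring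
      rw [e]
      refine ⟨abs_add_le _ _, ?_⟩
      have := abs_sub_abs_le_abs_sub (x - x₀) (-s)
      rwa [abs_neg, sub_neg_eq_add] at this
    have p0 : ∀ x, 0 ≤ iteratedAverage a f (N + 1) x := fun x =>
      le_inv_mul_integral (hc x) (ha N) fun s _ => i0 _
    have p1 : ∀ x, iteratedAverage a f (N + 1) x ≤ 1 := fun x =>
      inv_mul_integral_le (hc x) (ha N) fun s _ => i1 _
    refine ⟨p0, p1, fun x hx => le_antisymm (p1 x) ?_, fun x hx => le_antisymm ?_ (p0 x)⟩
    · rw [Finset.sum_range_succ] at hx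
      refine le_inv_mul_integral (hc x) (ha N) fun s hs' => (ir _ ?_).ge
      linarith [(htri x s).1, hs s hs']
    · rw [Finset.sum_range_succ] at hx
      refine inv_mul_integral_le (hc x) (ha N) fun s hs' => (iR _ ?_).le
      linarith [(htri x s).2, hs s hs']

lemma iteratedAverage_eq_integral {a : ℕ → ℝ} (ha : ∀ i, 0 < a i) {f : ℝ → ℝ} {g : ℝ → ℂ}
    (hg : Integrable g)
    (hfg : ∀ x : ℝ, (f x : ℂ) = ∫ t : ℝ, g t * Complex.exp ((2 * Real.pi * t * x : ℝ) * Complex.I))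
    (N : ℕ) :
    Integrable (fun t : ℝ => (∏ i ∈ Finset.range N, Real.sinc (2 * Real.pi * a i * t) : ℝ) * g t) ∧
    ∀ x : ℝ, (iteratedAverage a f N x : ℂ) = ∫ t : ℝ,
      (∏ i ∈ Finset.range N, Real.sinc (2 * Real.pi * a i * t) : ℝ) * g t *
        Complex.exp ((2 * Real.pi * t * x : ℝ) * Complex.I) := by
  induction N with
  | zero => simpa [iteratedAverage] using And.intro hg hfg
  | succ N ih =>
    obtain ⟨hi, hx⟩ := ih
    constructor
    · refine hg.bdd_mul (c := 1) (Continuous.aestronglyMeasurable ?_) (.of_forall fun t => ?_)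
      · exact Complex.continuous_ofReal.comp (continuous_finsetProd _ fun i _ =>
          Real.continuous_sinc.comp (by fun_prop))
      · rw [Complex.norm_real, Real.norm_eq_abs, Finset.abs_prod]
        exact Finset.prod_le_one (fun _ _ => abs_nonneg _) fun _ _ => Real.abs_sinc_le_one _
    · intro x
      have := integral_mul_sinc_mul_exp hi (ha N) x
      simp_rw [← hx, intervalIntegral.integral_ofReal] at this
      rw [iteratedAverage, Complex.ofReal_mul, ← this]
      congr 1; ext t
      rw [Finset.prod_range_succ]; push_cast; ring

/-- `φ` is a plateau function at `x₀`, equal to `1` at distance at most `r` and to `0` at distance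
at least `R`, and it is the Fourier transform of a function `g` which stays integrable against
all the weights `exp (c * |t| ^ γ)`. -/
structure IsFourierPlateau (γ x₀ r R : ℝ) (φ : ℝ → ℝ) (g : ℝ → ℂ) : Prop where
  nonneg : ∀ x, 0 ≤ φ x
  le_one : ∀ x, φ x ≤ 1
  eq_one : ∀ x, |x - x₀| ≤ r → φ x = 1
  eq_zero : ∀ x, R ≤ |x - x₀| → φ x = 0
  aestronglyMeasurable : AEStronglyMeasurable g
  integrable : ∀ c : ℝ, Integrable fun t : ℝ => Real.exp (c * |t| ^ γ) * ‖g t‖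
  eq_integral : ∀ x : ℝ, (φ x : ℂ) =
    ∫ t : ℝ, g t * Complex.exp ((2 * Real.pi * t * x : ℝ) * Complex.I)

lemma IsFourierPlateau.integrable_self {γ x₀ r R : ℝ} {φ : ℝ → ℝ} {g : ℝ → ℂ}
    (h : IsFourierPlateau γ x₀ r R φ g) : Integrable g := by
  rw [← integrable_norm_iff h.aestronglyMeasurable]
  simpa using h.integrable 0

lemma IsFourierPlateau.continuous {γ x₀ r R : ℝ} {φ : ℝ → ℝ} {g : ℝ → ℂ}
    (h : IsFourierPlateau γ x₀ r R φ g) : Continuous φ := by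
  have : Continuous fun x : ℝ =>
      ∫ t : ℝ, g t * Complex.exp ((2 * Real.pi * t * x : ℝ) * Complex.I) := by
    refine continuous_of_dominated (bound := fun t => ‖g t‖) (fun x => ?_)
      (fun x => .of_forall fun t => ?_) h.integrable_self.norm (.of_forall fun t => by fun_prop)
    · exact h.aestronglyMeasurable.mul (Continuous.aestronglyMeasurable (by fun_prop))
    · rw [norm_mul, Complex.norm_exp_ofReal_mul_I, mul_one]
  have h2 : φ = fun x : ℝ =>
      (∫ t : ℝ, g t * Complex.exp ((2 * Real.pi * t * x : ℝ) * Complex.I)).re := by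
    ext x; rw [← h.eq_integral x, Complex.ofReal_re]
  rw [h2]
  exact Complex.continuous_re.comp this

/-- A smooth plateau function together with its integrable Fourier transform. -/
lemma exists_smooth_plateau (x₀ : ℝ) {r R : ℝ} (hr : 0 < r) (hR : r < R) :
    ∃ (f : ℝ → ℝ) (g : ℝ → ℂ), Continuous f ∧ (∀ x, 0 ≤ f x) ∧ (∀ x, f x ≤ 1) ∧
      (∀ x, |x - x₀| ≤ r → f x = 1) ∧ (∀ x, R ≤ |x - x₀| → f x = 0) ∧ Integrable g ∧
      ∀ x : ℝ, (f x : ℂ) = ∫ t : ℝ, g t * Complex.exp ((2 * Real.pi * t * x : ℝ) * Complex.I) := by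
  let f : ContDiffBump x₀ := ⟨r, R, hr, hR⟩
  have hfs : HasCompactSupport fun x => (f x : ℂ) :=
    f.hasCompactSupport.comp_left (g := fun y : ℝ => (y : ℂ)) rfl
  have hfd : ContDiff ℝ ((⊤ : ℕ∞) : WithTop ℕ∞) fun x => (f x : ℂ) :=
    (Complex.ofRealCLM.contDiff).comp f.contDiff
  let F : SchwartzMap ℝ ℂ := hfs.toSchwartzMap hfd
  refine ⟨f, FourierTransform.fourier F, f.continuous, fun x => f.nonneg, fun x => f.le_one,
    fun x hx => f.one_of_mem_closedBall (by simpa [Real.dist_eq] using hx),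
    fun x hx => f.zero_of_le_dist (by simpa [Real.dist_eq] using hx),
    SchwartzMap.integrable _, fun x => ?_⟩
  have h1 : FourierTransformInv.fourierInv (FourierTransform.fourier F) = F :=
    FourierTransform.fourierInv_fourier_eq F
  have h2 : (F : ℝ → ℂ) x =
      FourierTransformInv.fourierInv (FourierTransform.fourier F : ℝ → ℂ) x := by
    rw [← SchwartzMap.fourierInv_coe, h1]
  have h3 : (F : ℝ → ℂ) x = f x := rfl
  rw [← h3, h2, Real.fourierInv_eq']
  congr 1; ext t
  simp only [smul_eq_mul]
  rw [mul_comm]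
  congr 3
  simp
  ring

/-- Plateau functions with arbitrarily prescribed radii exist for every exponent `γ < 1`. -/
lemma exists_isFourierPlateau {γ : ℝ} (hγ : 0 < γ) (hγ1 : γ < 1) (x₀ : ℝ) {r R : ℝ}
    (hr : 0 < r) (hR : r < R) : ∃ φ g, IsFourierPlateau γ x₀ r R φ g := by
  obtain ⟨s, hs1, hs2⟩ := exists_between ((one_lt_div hγ).2 hγ1)
  have hγs : γ < 1 / s := by
    rw [lt_div_iff₀ (by linarith)]; rw [lt_div_iff₀ hγ] at hs2; linarith
  have hsum : Summable fun i : ℕ => 1 / ((i : ℝ) + 1) ^ s := by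
    have := (summable_nat_add_iff 1).2 (Real.summable_one_div_nat_rpow.2 hs1)
    simpa using this
  set S := ∑' i : ℕ, 1 / ((i : ℝ) + 1) ^ s with hS
  have hS0 : 0 ≤ S := tsum_nonneg fun i => by positivity
  set d := (R - r) / 3 with hd
  have hd0 : 0 < d := by rw [hd]; linarith
  set δ := d / (S + 1) with hδ
  have hδ0 : 0 < δ := by positivity
  set a : ℕ → ℝ := fun i => δ / ((i : ℝ) + 1) ^ s with ha
  have ha0 : ∀ i, 0 < a i := fun i => by positivity
  have haS : Summable a := by
    simpa [ha, div_eq_mul_inv] using hsum.mul_left δ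
  have hpart : ∀ N, ∑ i ∈ Finset.range N, a i ≤ d := fun N => by
    calc ∑ i ∈ Finset.range N, a i = δ * ∑ i ∈ Finset.range N, 1 / ((i : ℝ) + 1) ^ s := by
          rw [Finset.mul_sum]; congr 1; ext i; simp [ha, div_eq_mul_inv]
      _ ≤ δ * (S + 1) := by
          gcongr
          linarith [hsum.sum_le_tsum (Finset.range N) fun i _ => by positivity]
      _ = d := by rw [hδ]; field_simp
  obtain ⟨f, g, hfc, hf0, hf1, hfr, hfR, hg, hfg⟩ :=
    exists_smooth_plateau x₀ (r := r + d) (R := r + 2 * d) (by linarith) (by linarith)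
  have hgint := iteratedAverage_eq_integral ha0 hg hfg
  have hpl := iteratedAverage_plateau ha0 hfc hf0 hf1 hfr hfR
  set P : ℕ → ℝ → ℝ := fun N t => ∏ i ∈ Finset.range N, Real.sinc (2 * Real.pi * a i * t) with hP
  have hPc : ∀ N, Continuous (P N) := fun N =>
    continuous_finsetProd _ fun i _ => Real.continuous_sinc.comp (by fun_prop)
  have hP1 : ∀ N t, |P N t| ≤ 1 := fun N t => by
    rw [hP, Finset.abs_prod]
    exact Finset.prod_le_one (fun _ _ => abs_nonneg _) fun _ _ => Real.abs_sinc_le_one _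
  have hlim : ∀ t, ∃ y, Tendsto (fun N => P N t) atTop (𝓝 y) := fun t => by
    have hm : Multipliable fun i => 1 + (Real.sinc (2 * Real.pi * a i * t) - 1) := by
      refine multipliable_one_add_of_summable ?_
      refine Summable.of_nonneg_of_le (fun _ => norm_nonneg _) (fun i => abs_sinc_sub_one_le _)
        ((haS.mul_left (4 * Real.pi * |t|)).congr fun i => ?_)
      rw [abs_mul, abs_of_pos (by have := ha0 i; positivity : 0 < 2 * Real.pi * a i)]; ring
    exact ⟨_, hm.hasProd.tendsto_prod_nat.congr fun N => by simp [hP]⟩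
  choose Q hQ using hlim
  have hQm : Measurable Q := measurable_of_tendsto_metrizable (fun N => (hPc N).measurable)
    (tendsto_pi_nhds.2 hQ)
  have hI : ∀ x : ℝ, Tendsto (fun N => (iteratedAverage a f N x : ℂ)) atTop
      (𝓝 (∫ t : ℝ, (Q t : ℂ) * g t * Complex.exp ((2 * Real.pi * t * x : ℝ) * Complex.I))) := by
    intro x
    simp_rw [(hgint _).2]
    refine tendsto_integral_of_dominated_convergence (fun t => ‖g t‖) (fun N => ?_) hg.norm
      (fun N => .of_forall fun t => ?_) (.of_forall fun t => ?_)
    · exact ((hgint N).1.aestronglyMeasurable).mul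
        (Continuous.aestronglyMeasurable (by fun_prop))
    · rw [norm_mul, Complex.norm_exp_ofReal_mul_I, mul_one, norm_mul, Complex.norm_real,
        Real.norm_eq_abs]
      exact mul_le_of_le_one_left (norm_nonneg _) (hP1 N t)
    · exact ((Complex.continuous_ofReal.tendsto _).comp (hQ t)).mul_const _ |>.mul_const _
  have hIre : ∀ x : ℝ, Tendsto (fun N => iteratedAverage a f N x) atTop
      (𝓝 (∫ t : ℝ, (Q t : ℂ) * g t *
        Complex.exp ((2 * Real.pi * t * x : ℝ) * Complex.I)).re) := fun x => by
    simpa using! (Complex.continuous_re.tendsto _).comp (hI x)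
  refine ⟨fun x => (∫ t : ℝ, (Q t : ℂ) * g t *
      Complex.exp ((2 * Real.pi * t * x : ℝ) * Complex.I)).re, fun t => Q t * g t,
    fun x => ge_of_tendsto' (hIre x) fun N => (hpl N).1 x,
    fun x => le_of_tendsto' (hIre x) fun N => (hpl N).2.1 x,
    fun x hx => tendsto_nhds_unique (hIre x) ?_, fun x hx => tendsto_nhds_unique (hIre x) ?_,
    ?_, fun c => ?_, fun x => ?_⟩
  · refine tendsto_const_nhds.congr fun N => ((hpl N).2.2.1 x ?_).symm
    linarith [hpart N]
  · refine tendsto_const_nhds.congr fun N => ((hpl N).2.2.2 x ?_).symm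
    linarith [hpart N]
  · exact (Complex.measurable_ofReal.comp hQm).aestronglyMeasurable.mul hg.aestronglyMeasurable
  · obtain ⟨K, hK⟩ := exists_prod_sinc_mul_exp_le hs1 hδ0 hγ hγs c
    have hQK : ∀ t, |Q t| * Real.exp (c * |t| ^ γ) ≤ K := fun t =>
      le_of_tendsto (((hQ t).abs).mul_const _) (hK t)
    have : (fun t : ℝ => Real.exp (c * |t| ^ γ) * ‖(Q t : ℂ) * g t‖) =
        fun t => (|Q t| * Real.exp (c * |t| ^ γ)) * ‖g t‖ := by
      ext t; rw [norm_mul, Complex.norm_real, Real.norm_eq_abs]; ring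
    rw [this]
    refine hg.norm.bdd_mul (c := K) ?_ (.of_forall fun t => ?_)
    · exact (Measurable.mul hQm.abs (by fun_prop)).aestronglyMeasurable
    · rw [Real.norm_eq_abs, abs_of_nonneg (by positivity)]; exact hQK t
  · have := (Complex.continuous_ofReal.tendsto _).comp (hIre x)
    exact tendsto_nhds_unique this (hI x)

open NormedSpace in
lemma norm_exp_mul_sub_le {A : Type*} [NormedRing A] [NormedAlgebra ℂ A] [CompleteSpace A]
    (y x : A) : ‖exp y * x - x‖ ≤ Real.exp ‖y‖ * ‖y * x‖ := by
  have h1 : HasSum (fun n : ℕ => ((n.factorial : ℂ)⁻¹ • y ^ n) * x) (exp y * x) :=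
    (exp_series_hasSum_exp' (𝕂 := ℂ) y).mul_right x
  have h2 : HasSum (fun n : ℕ => (((n + 1).factorial : ℂ)⁻¹ • y ^ (n + 1)) * x)
      (exp y * x - x) := by
    simpa using (hasSum_nat_add_iff' 1).2 h1
  have h3 : HasSum (fun n : ℕ => ((n.factorial : ℝ)⁻¹ • ‖y‖ ^ n) * ‖y * x‖)
      (Real.exp ‖y‖ * ‖y * x‖) := by
    rw [Real.exp_eq_exp_ℝ]
    exact (exp_series_hasSum_exp' (𝕂 := ℝ) ‖y‖).mul_right _
  have hle : ∀ n : ℕ, ‖(((n + 1).factorial : ℂ)⁻¹ • y ^ (n + 1)) * x‖ ≤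
      ((n.factorial : ℝ)⁻¹ • ‖y‖ ^ n) * ‖y * x‖ := fun n => by
    have hpow : ‖y ^ n * (y * x)‖ ≤ ‖y‖ ^ n * ‖y * x‖ := by
      rcases Nat.eq_zero_or_pos n with rfl | hn
      · simp
      · exact (norm_mul_le _ _).trans (by gcongr; exact norm_pow_le' y hn)
    rw [smul_mul_assoc, pow_succ, mul_assoc, norm_smul, norm_inv, Complex.norm_natCast,
      smul_eq_mul, mul_assoc]
    gcongr
    exact n.le_succ
  rw [← h2.tsum_eq, ← h3.tsum_eq]
  exact tsum_of_norm_bounded h3 hle |>.trans_eq h3.tsum_eq.symm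

lemma rpow_growth_of_dilation_le {k : ℕ} (hk : 2 ≤ k) {p D b : ℝ} (hp : 1 < p) (hD : 0 ≤ D)
    (hb : 0 ≤ b) {f : ℝ → ℝ} (hfb : ∀ t, |t| ≤ 1 → f t ≤ b)
    (hf : ∀ t, f (k * t) ≤ D + p * f t) (t : ℝ) :
    f t ≤ p * (b + D / (p - 1)) * (1 + |t| ^ (Real.log p / Real.log k)) := by
  have hk0 : (1 : ℝ) < k := by exact_mod_cast hk
  have hp1 : 0 < p - 1 := by linarith
  have hE : 0 ≤ D / (p - 1) := by positivity
  have hind : ∀ n : ℕ, ∀ t : ℝ, |t| ≤ (k : ℝ) ^ n →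
      f t + D / (p - 1) ≤ (b + D / (p - 1)) * p ^ n := by
    intro n
    induction n with
    | zero => intro t ht; simpa using hfb t (by simpa using ht)
    | succ n ih =>
      intro t ht
      have h1 := ih (t / k) (by
        rw [abs_div, Nat.abs_cast, div_le_iff₀ (by linarith)]; simpa [pow_succ] using ht)
      have h2 := hf (t / k)
      rw [mul_div_cancel₀ _ (by linarith)] at h2
      have h3 : p * (D / (p - 1)) = D + D / (p - 1) := by field_simp; ring
      calc f t + D / (p - 1) ≤ p * (f (t / k) + D / (p - 1)) := by rw [mul_add, h3]; linarith
        _ ≤ p * ((b + D / (p - 1)) * p ^ n) := by gcongr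
        _ = _ := by ring
  have hpos : 0 ≤ |t| ^ (Real.log p / Real.log k) := by positivity
  have hbE : 0 ≤ b + D / (p - 1) := by positivity
  rcases le_total |t| 1 with ht | ht
  · have : b ≤ (b + D / (p - 1)) * 1 := by linarith
    nlinarith [hfb t ht, mul_nonneg hbE hpos, mul_nonneg hp1.le hbE,
      mul_nonneg hp1.le (mul_nonneg hbE hpos)]
  · obtain ⟨n, hn1, hn2⟩ := exists_nat_pow_near ht hk0
    have h1 := hind (n + 1) t hn2.le
    have h2 : p ^ n ≤ |t| ^ (Real.log p / Real.log k) := by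
      have hlk : 0 < Real.log k := Real.log_pos hk0
      have hlp : 0 < Real.log p := Real.log_pos hp
      have h3 : ((k : ℝ) ^ n) ^ (Real.log p / Real.log k) = p ^ n := by
        rw [← Real.rpow_natCast, ← Real.rpow_natCast, ← Real.rpow_mul (by linarith),
          Real.rpow_def_of_pos (by linarith), Real.rpow_def_of_pos (by linarith)]
        congr 1
        field_simp
      rw [← h3]
      gcongr
    calc f t ≤ (b + D / (p - 1)) * p ^ (n + 1) := by linarith
      _ = p * (b + D / (p - 1)) * p ^ n := by ring
      _ ≤ p * (b + D / (p - 1)) * (1 + |t| ^ (Real.log p / Real.log k)) := by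
        gcongr; linarith

section Calculus

open NormedSpace

variable {A B : Type*} [NormedRing A] [StarRing A] [NormedAlgebra ℂ A] [CompleteSpace A]
  [CStarAlgebra B] {ι : A →⋆ₙₐ[ℂ] B}

lemma isStarProjection_map_one (ι : A →⋆ₙₐ[ℂ] B) : IsStarProjection (ι 1) :=
  ⟨by rw [IsIdempotentElem, ← map_mul, mul_one], by rw [IsSelfAdjoint, ← map_star, star_one]⟩

lemma norm_map_one_le (ι : A →⋆ₙₐ[ℂ] B) : ‖ι 1‖ ≤ 1 :=
  IsStarProjection.norm_le _ (isStarProjection_map_one ι)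

lemma map_mul_map_one (ι : A →⋆ₙₐ[ℂ] B) (a : A) : ι a * ι 1 = ι a := by
  rw [← map_mul, mul_one]

lemma map_one_mul_map (ι : A →⋆ₙₐ[ℂ] B) (a : A) : ι 1 * ι a = ι a := by
  rw [← map_mul, one_mul]

lemma map_exp_eq (hι : Continuous ι) (a : A) : ι (exp a) = exp (ι a) * ι 1 := by
  have h1 := (exp_series_hasSum_exp' (𝕂 := ℂ) a).map ι hι
  have h2 := (exp_series_hasSum_exp' (𝕂 := ℂ) (ι a)).mul_right (ι 1)
  have h3 : (ι ∘ fun n : ℕ => ((n.factorial : ℂ)⁻¹ • a ^ n)) =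
      fun n : ℕ => ((n.factorial : ℂ)⁻¹ • ι a ^ n) * ι 1 := by
    funext n
    rcases n with _ | n
    · simp
    · simp only [Function.comp_apply, map_smul, smul_mul_assoc]
      congr 1
      induction n with
      | zero => simp [map_mul_map_one]
      | succ n ih => rw [pow_succ', map_mul, ih, pow_succ' (ι a) (n + 1), mul_assoc]
  rw [h3] at h1
  exact h1.unique h2

/-- The one-parameter groups generated by self-adjoint elements have norms growing at most like
`exp (c * |t| ^ γ)`, uniformly on bounded sets. -/
def HasExpGrowth (A : Type*) [NormedRing A] [StarRing A] [NormedAlgebra ℂ A] (γ : ℝ) : Prop :=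
  ∀ M : ℝ, ∃ K c : ℝ, ∀ h : A, IsSelfAdjoint h → ‖h‖ ≤ M → ∀ t : ℝ,
    ‖exp (((2 * Real.pi * t : ℝ) * Complex.I) • h)‖ ≤ K * Real.exp (c * |t| ^ γ)

lemma norm_exp_I_smul_mul_le {h : B} (hh : IsSelfAdjoint h) (t : ℝ) (x : B) :
    ‖exp ((t * Complex.I) • h) * x‖ = ‖x‖ := by
  let u := selfAdjoint.expUnitary (t • (⟨h, hh⟩ : selfAdjoint B))
  have : (u : B) = exp ((t * Complex.I) • h) := by
    simp only [u, selfAdjoint.expUnitary_coe, selfAdjoint.val_smul]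
    congr 1
    rw [mul_comm, mul_smul, Complex.coe_smul]
  rw [← this, CStarRing.norm_coe_unitary_mul]

lemma hasExpGrowth_of_differential (hι : Continuous ι) {k : ℕ} (hk : 2 ≤ k) {p q : ℝ}
    (hp : 0 < p) (hq : 0 < q) (hpq : p + q = (k : ℝ)) {C : ℝ}
    (hdiff : ∀ a : A, ‖a ^ k‖ ≤ C * ‖a‖ ^ p * ‖ι a‖ ^ q) :
    ∃ γ : ℝ, 0 < γ ∧ γ < 1 ∧ HasExpGrowth A γ := by
  have hk2 : (2 : ℝ) ≤ k := by exact_mod_cast hk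
  set p' := max p (3 / 2) with hp'
  have hp'1 : 1 < p' := lt_max_of_lt_right (by norm_num)
  have hp'k : p' < k := max_lt (by linarith) (by linarith)
  have hlp : 0 < Real.log p' := Real.log_pos hp'1
  have hlk : Real.log p' < Real.log k := Real.log_lt_log (by linarith) hp'k
  refine ⟨Real.log p' / Real.log k, div_pos hlp (hlp.trans hlk),
    (div_lt_one (hlp.trans hlk)).2 hlk, fun M => ?_⟩
  set γ := Real.log p' / Real.log k
  set N := max 0 M
  set D := Real.log (max 1 C)
  set b := Real.log (1 + ‖(1 : A)‖ + Real.exp N * (N * ‖(1 : A)‖))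
  have hN : 0 ≤ N := le_max_left _ _
  have hD : 0 ≤ D := Real.log_nonneg (le_max_left _ _)
  have hb1 : 1 ≤ 1 + ‖(1 : A)‖ + Real.exp N * (N * ‖(1 : A)‖) := by
    have : 0 ≤ ‖(1 : A)‖ + Real.exp N * (N * ‖(1 : A)‖) := by positivity
    linarith
  have hb : 0 ≤ b := Real.log_nonneg hb1
  set E := p' * (b + D / (p' - 1))
  refine ⟨Real.exp E, E * (2 * Real.pi) ^ γ, fun h hh hM t => ?_⟩
  set f : ℝ → ℝ := fun t => Real.log (max 1 ‖exp ((t * Complex.I) • h)‖) with hf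
  have h1 : ∀ t, |t| ≤ 1 → f t ≤ b := fun t ht => by
    refine Real.log_le_log (by positivity) (max_le hb1 ?_)
    have hy : ‖((t : ℂ) * Complex.I) • h‖ ≤ N := by
      rw [norm_smul, norm_mul, Complex.norm_I, mul_one, Complex.norm_real, Real.norm_eq_abs]
      exact (mul_le_of_le_one_left (norm_nonneg _) ht).trans (hM.trans (le_max_right _ _))
    have h2 := norm_exp_mul_sub_le (((t : ℂ) * Complex.I) • h) (1 : A)
    rw [mul_one] at h2
    have h3 := norm_le_norm_add_norm_sub' (exp (((t : ℂ) * Complex.I) • h)) (1 : A)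
    have h4 : Real.exp ‖((t : ℂ) * Complex.I) • h‖ * ‖((t : ℂ) * Complex.I) • h * 1‖ ≤
        Real.exp N * (N * ‖(1 : A)‖) := by
      gcongr
      exact (norm_mul_le _ _).trans (by gcongr)
    linarith
  have h2 : ∀ t, f (k * t) ≤ D + p' * f t := fun t => by
    have hG : 1 ≤ max 1 ‖exp ((t * Complex.I) • h)‖ := le_max_left _ _
    rw [hf, ← Real.log_rpow (by positivity), ← Real.log_mul (by positivity) (by positivity)]
    refine Real.log_le_log (by positivity) (max_le ?_ ?_)
    · exact one_le_mul_of_one_le_of_one_le (le_max_left _ _)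
        (Real.one_le_rpow hG (by linarith))
    · have h3 : exp ((((k * t : ℝ) : ℂ) * Complex.I) • h) = exp ((t * Complex.I) • h) ^ k := by
        let _ : NormedAlgebra ℚ A := NormedAlgebra.restrictScalars ℚ ℂ A
        rw [← exp_nsmul]
        congr 1
        rw [← Nat.cast_smul_eq_nsmul ℂ, smul_smul]
        push_cast; ring_nf
      rw [h3]
      have h4 : ‖ι (exp ((t * Complex.I) • h))‖ ≤ 1 := by
        rw [map_exp_eq hι, map_smul, norm_exp_I_smul_mul_le (hh.map ι)]
        exact norm_map_one_le ι
      calc ‖exp ((t * Complex.I) • h) ^ k‖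
          ≤ C * ‖exp ((t * Complex.I) • h)‖ ^ p * ‖ι (exp ((t * Complex.I) • h))‖ ^ q := hdiff _
        _ ≤ max 1 C * ‖exp ((t * Complex.I) • h)‖ ^ p * 1 := by
            gcongr
            · exact le_max_right _ _
            · exact Real.rpow_le_one (norm_nonneg _) h4 hq.le
        _ ≤ max 1 C * (max 1 ‖exp ((t * Complex.I) • h)‖) ^ p' := by
            rw [mul_one]
            gcongr
            exact (Real.rpow_le_rpow (norm_nonneg _) (le_max_right _ _) hp.le).trans
              (Real.rpow_le_rpow_of_exponent_le hG (le_max_left _ _))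
  have h3 := rpow_growth_of_dilation_le hk hp'1 hD hb h1 h2 (2 * Real.pi * t)
  have h4 : ‖exp (((2 * Real.pi * t : ℝ) * Complex.I) • h)‖ ≤ Real.exp (f (2 * Real.pi * t)) := by
    rw [hf, Real.exp_log (by positivity)]
    exact le_max_right _ _
  refine h4.trans ?_
  rw [← Real.exp_add, Real.exp_le_exp]
  refine h3.trans_eq ?_
  rw [abs_mul, abs_of_pos Real.two_pi_pos, Real.mul_rpow (by positivity) (abs_nonneg _)]
  ring

end Calculus

section Calculus

open NormedSpace

variable {A B : Type*} [NormedRing A] [StarRing A] [NormedAlgebra ℂ A] [CompleteSpace A]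
  [CStarAlgebra B] {ι : A →⋆ₙₐ[ℂ] B}

/-- The element of a Banach algebra obtained by integrating `g` against the one-parameter group
generated by `h`. -/
noncomputable def fourierCalc (g : ℝ → ℂ) (h : A) : A :=
  ∫ t : ℝ, g t • exp (((2 * Real.pi * t : ℝ) * Complex.I) • h)

lemma continuous_exp_smul (h : A) :
    Continuous fun t : ℝ => exp (((2 * Real.pi * t : ℝ) * Complex.I) • h) := by
  let _ : NormedAlgebra ℚ A := NormedAlgebra.restrictScalars ℚ ℂ A
  exact NormedSpace.exp_continuous.comp (by fun_prop)

variable {γ x₀ r R : ℝ} {φ : ℝ → ℝ} {g : ℝ → ℂ}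

lemma IsFourierPlateau.integrable_smul_exp (hg : IsFourierPlateau γ x₀ r R φ g)
    (hA : HasExpGrowth A γ) {h : A} (hh : IsSelfAdjoint h) :
    Integrable fun t : ℝ => g t • exp (((2 * Real.pi * t : ℝ) * Complex.I) • h) := by
  obtain ⟨K, c, hK⟩ := hA ‖h‖
  refine ((hg.integrable c).const_mul K).mono'
    (hg.aestronglyMeasurable.smul (continuous_exp_smul h).aestronglyMeasurable)
    (.of_forall fun t => ?_)
  rw [norm_smul, mul_comm, ← mul_assoc]
  gcongr
  exact hK h hh le_rfl t

lemma IsFourierPlateau.cfc_eq_integral (hg : IsFourierPlateau γ x₀ r R φ g) {b : B}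
    (hb : IsSelfAdjoint b) :
    cfc φ b = ∫ t : ℝ, g t • exp (((2 * Real.pi * t : ℝ) * Complex.I) • b) := by
  set f : ℝ → ℂ → ℂ := fun t z => Complex.exp (((2 * Real.pi * t : ℝ) * Complex.I) * z) with hf
  have hfc : ∀ t, ContinuousOn (f t) (spectrum ℂ b) := fun t => by
    simp only [hf]; fun_prop
  have hgf : ∀ t, ContinuousOn (fun z => g t * f t z) (spectrum ℂ b) := fun t =>
    continuousOn_const.mul (hfc t)
  have h1 : cfc φ b = cfc (fun z : ℂ => ∫ t : ℝ, g t * f t z) b := by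
    rw [cfc_real_eq_complex φ hb]
    refine cfc_congr fun z hz => ?_
    simp only [hg.eq_integral z.re, hf]
    congr 1
    ext t
    rw [hb.mem_spectrum_eq_re hz]
    push_cast
    congr 2
    simp
    ring
  have hcont : Continuous fun t => ContinuousMap.mkD ((spectrum ℂ b).domRestrict (f t)) 0 :=
    ContinuousMap.continuous_mkD_restrict_of_uncurry _ _ (by
      refine Continuous.continuousOn ?_
      simp only [hf, Function.uncurry_def]
      fun_prop)
  have h2 : ∀ t, ContinuousMap.mkD ((spectrum ℂ b).domRestrict (fun z => g t * f t z)) 0 =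
      g t • ContinuousMap.mkD ((spectrum ℂ b).domRestrict (f t)) 0 := fun t => by
    ext z
    rw [ContinuousMap.mkD_apply_of_continuousOn (hgf t), ContinuousMap.smul_apply,
      ContinuousMap.mkD_apply_of_continuousOn (hfc t), smul_eq_mul]
  have h3 : Integrable fun t =>
      ContinuousMap.mkD ((spectrum ℂ b).domRestrict (fun z => g t * f t z)) 0 := by
    simp_rw [h2]
    refine hg.integrable_self.norm.mono'
      (hg.aestronglyMeasurable.smul hcont.aestronglyMeasurable) (.of_forall fun t => ?_)
    rw [norm_smul]
    refine mul_le_of_le_one_right (norm_nonneg _) ?_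
    rw [ContinuousMap.norm_le _ zero_le_one]
    intro z
    rw [ContinuousMap.mkD_apply_of_continuousOn (hfc t), hf, hb.mem_spectrum_eq_re z.2]
    dsimp only
    rw [mul_right_comm, ← Complex.ofReal_mul, Complex.norm_exp_ofReal_mul_I]
  rw [h1, cfc_integral' _ _ (.of_forall hgf) h3]
  congr 1
  ext t
  rw [cfc_const_mul _ _ _ (hfc t)]
  congr 1
  simp only [hf]
  rw [cfc_comp_const_mul _ Complex.exp b (by fun_prop),
    CFC.complex_exp_eq_normedSpace_exp (p := IsStarNormal)
      ⟨by simpa using ((hb.isStarNormal.star_comm_self).smul_left _).smul_right _⟩]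

lemma IsFourierPlateau.map_fourierCalc (hg : IsFourierPlateau γ x₀ r R φ g)
    (hA : HasExpGrowth A γ) (hι : Continuous ι) {h : A} (hh : IsSelfAdjoint h) :
    ι (fourierCalc g h) = cfc φ (ι h) * ι 1 := by
  let T : A →L[ℂ] B := ⟨{ toFun := ι, map_add' := map_add ι, map_smul' := map_smul ι }, hι⟩
  let S : B →L[ℂ] B := (ContinuousLinearMap.mul ℂ B).flip (ι 1)
  have hT : ∀ a, T a = ι a := fun _ => rfl
  have hS : ∀ b, S b = b * ι 1 := fun _ => rfl
  have hgint : Integrable fun t : ℝ => g t • exp (((2 * Real.pi * t : ℝ) * Complex.I) • ι h) := by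
    refine (hg.integrable_self.norm.mul_const ‖(1 : B)‖).mono'
      (hg.aestronglyMeasurable.smul (continuous_exp_smul _).aestronglyMeasurable)
      (.of_forall fun t => ?_)
    rw [norm_smul]
    have := norm_exp_I_smul_mul_le (hh.map ι) (2 * Real.pi * t) 1
    rw [mul_one] at this
    rw [this]
  rw [hg.cfc_eq_integral (hh.map ι), ← hT, ← hS, ← S.integral_comp_comm hgint, fourierCalc,
    ← T.integral_comp_comm (hg.integrable_smul_exp hA hh)]
  congr 1
  ext t
  rw [map_smul, map_smul, hT, hS, map_exp_eq hι, map_smul]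

/-- `a` is mapped by `ι` to the function `f` of `ι h` in the corner cut out by `ι 1`. -/
structure Represents (ι : A →⋆ₙₐ[ℂ] B) (h : A) (f : ℝ → ℝ) (a : A) : Prop where
  continuous : Continuous f
  map_eq : ι a = cfc f (ι h) * ι 1

namespace Represents

variable {h : A} {f f' : ℝ → ℝ} {a b : A}

lemma one (hh : IsSelfAdjoint h) : Represents ι h (fun _ => 1) 1 :=
  ⟨continuous_const, by rw [cfc_const (1 : ℝ) (ι h) (hh.map ι)]; simp⟩

lemma self (hh : IsSelfAdjoint h) : Represents ι h (fun x => x) h :=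
  ⟨continuous_id, by rw [cfc_id' ℝ (ι h) (hh.map ι), map_mul_map_one]⟩

lemma mul (ha : Represents ι h f a) (hb : Represents ι h f' b) :
    Represents ι h (fun x => f x * f' x) (a * b) :=
  ⟨ha.1.mul hb.1, by
    rw [map_mul, ha.2, mul_assoc, map_one_mul_map, hb.2, ← mul_assoc,
      cfc_mul f f' (ι h) ha.1.continuousOn hb.1.continuousOn]⟩

lemma sub (ha : Represents ι h f a) (hb : Represents ι h f' b) :
    Represents ι h (fun x => f x - f' x) (a - b) :=
  ⟨ha.1.sub hb.1, by
    rw [map_sub, ha.2, hb.2, ← sub_mul, cfc_sub f f' (ι h) ha.1.continuousOn hb.1.continuousOn]⟩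

lemma const_smul (c : ℝ) (ha : Represents ι h f a) :
    Represents ι h (fun x => c * f x) ((c : ℂ) • a) :=
  ⟨ha.1.const_mul c, by
    rw [map_smul, ha.2, cfc_const_mul c f (ι h) ha.1.continuousOn, smul_mul_assoc,
      Complex.coe_smul]⟩

lemma eq_of_eqOn (hinj : Function.Injective ι) (ha : Represents ι h f a)
    (hb : Represents ι h f' b) (hf : Set.EqOn f f' (spectrum ℝ (ι h))) : a = b :=
  hinj (by rw [ha.2, hb.2, cfc_congr hf])

lemma norm_le (ha : Represents ι h f a) {c : ℝ} (hc : 0 ≤ c)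
    (hf : ∀ x ∈ spectrum ℝ (ι h), |f x| ≤ c) : ‖ι a‖ ≤ c := by
  rw [ha.2]
  exact (norm_mul_le _ _).trans <|
    (mul_le_of_le_one_right (norm_nonneg _) (norm_map_one_le ι)).trans (norm_cfc_le hc hf)

lemma isSelfAdjoint (hinj : Function.Injective ι) (ha : Represents ι h f a) :
    IsSelfAdjoint a := by
  have h1 : Commute (cfc f (ι h)) (ι 1) := Commute.cfc_real (by
    rw [Commute, SemiconjBy, map_mul_map_one, map_one_mul_map]) f
  refine hinj ?_
  rw [map_star, ha.2, star_mul, (isStarProjection_map_one ι).isSelfAdjoint.star_eq,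
    IsSelfAdjoint.cfc.star_eq, h1.eq]

lemma exists_prod (hh : IsSelfAdjoint h) {P : A → Prop} (hP1 : P 1)
    (hP : ∀ x y, P x → P y → P (x * y)) {G : ℝ → ℝ → ℝ} (s : Finset ℝ)
    (hG : ∀ i ∈ s, ∃ a, Represents ι h (G i) a ∧ P a) :
    ∃ y, Represents ι h (fun x => ∏ i ∈ s, G i x) y ∧ P y := by
  classical
  induction s using Finset.induction_on with
  | empty => exact ⟨1, by simpa using one hh, hP1⟩
  | insert i s hi ih =>
    obtain ⟨a, ha, hPa⟩ := hG i (Finset.mem_insert_self _ _)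
    obtain ⟨y, hy, hPy⟩ := ih fun j hj => hG j (Finset.mem_insert_of_mem hj)
    exact ⟨a * y, by simpa [Finset.prod_insert hi] using ha.mul hy, hP _ _ hPa hPy⟩

end Represents

lemma IsFourierPlateau.represents (hg : IsFourierPlateau γ x₀ r R φ g)
    (hA : HasExpGrowth A γ) (hι : Continuous ι) {h : A} (hh : IsSelfAdjoint h) :
    Represents ι h φ (fourierCalc g h) :=
  ⟨hg.continuous, hg.map_fourierCalc hA hι hh⟩

lemma abs_le_norm_of_mem_spectrum {b : B} {x : ℝ} (hx : x ∈ spectrum ℝ b) : |x| ≤ ‖b‖ :=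
  (spectrum.norm_le_norm_mul_of_mem hx).trans
    (mul_le_of_le_one_right (norm_nonneg _) (IsStarProjection.norm_le _ (.one B)))

lemma exp_sub_exp_mem {I : Submodule ℂ A} (hI : IsClosed (I : Set A))
    (hI2 : ∀ a x : A, x ∈ I → a * x ∈ I ∧ x * a ∈ I) {x y : A} (hxy : x - y ∈ I) :
    exp x - exp y ∈ I := by
  have hpow : ∀ n : ℕ, x ^ n - y ^ n ∈ I := fun n => by
    induction n with
    | zero => simp
    | succ n ih =>
      have : x ^ (n + 1) - y ^ (n + 1) = x ^ n * (x - y) + (x ^ n - y ^ n) * y := by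
        simp only [pow_succ]; noncomm_ring
      rw [this]
      exact I.add_mem (hI2 _ _ hxy).1 (hI2 _ _ ih).2
  have h := (exp_series_hasSum_exp' (𝕂 := ℂ) x).sub (exp_series_hasSum_exp' (𝕂 := ℂ) y)
  refine hI.mem_of_tendsto h (.of_forall fun s => I.sum_mem fun n _ => ?_)
  rw [← smul_sub]
  exact I.smul_mem _ (hpow n)

lemma IsFourierPlateau.fourierCalc_sub_mem (hg : IsFourierPlateau γ x₀ r R φ g)
    (hA : HasExpGrowth A γ) {I : Submodule ℂ A} (hI : IsClosed (I : Set A))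
    (hI2 : ∀ a x : A, x ∈ I → a * x ∈ I ∧ x * a ∈ I) {h h' : A} (hh : IsSelfAdjoint h)
    (hh' : IsSelfAdjoint h') (hhh : h - h' ∈ I) : fourierCalc g h - fourierCalc g h' ∈ I := by
  have : IsClosed (I : Set A) := hI
  rw [fourierCalc, fourierCalc, ← integral_sub (hg.integrable_smul_exp hA hh)
    (hg.integrable_smul_exp hA hh'), ← Submodule.Quotient.mk_eq_zero]
  have hgint := (hg.integrable_smul_exp hA hh).sub (hg.integrable_smul_exp hA hh')
  have h1 := (Submodule.mkQL I).integral_comp_comm hgint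
  refine h1.symm.trans ?_
  rw [← integral_zero ℝ (A ⧸ I)]
  congr 1
  ext t
  refine (Submodule.Quotient.mk_eq_zero I).2 ?_
  simp only [Pi.sub_apply]
  rw [← smul_sub]
  refine I.smul_mem _ (exp_sub_exp_mem hI hI2 ?_)
  rw [← smul_sub]
  exact I.smul_mem _ hhh

lemma IsFourierPlateau.tendsto_fourierCalc_mul (hg : IsFourierPlateau γ x₀ r R φ g)
    (hA : HasExpGrowth A γ) {E : ℕ → A} (hE : ∀ n, IsSelfAdjoint (E n)) {M : ℝ}
    (hM : ∀ n, ‖E n‖ ≤ M) {x : A} (hx : Tendsto (fun n => E n * x) atTop (𝓝 x)) :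
    Tendsto (fun n => fourierCalc g (E n) * x) atTop (𝓝 ((φ 1 : ℂ) • x)) := by
  let _ : NormedAlgebra ℚ A := NormedAlgebra.restrictScalars ℚ ℂ A
  let S : A →L[ℂ] A := (ContinuousLinearMap.mul ℂ A).flip x
  have hS : ∀ b, S b = b * x := fun _ => rfl
  obtain ⟨K, c, hK⟩ := hA M
  have h1 : ∀ n, fourierCalc g (E n) * x =
      ∫ t : ℝ, g t • (exp (((2 * Real.pi * t : ℝ) * Complex.I) • E n) * x) := fun n => by
    rw [← hS, fourierCalc, ← S.integral_comp_comm (hg.integrable_smul_exp hA (hE n))]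
    simp only [hS, smul_mul_assoc]
  have h2 : (φ 1 : ℂ) • x =
      ∫ t : ℝ, g t • (Complex.exp ((2 * Real.pi * t : ℝ) * Complex.I) • x) := by
    rw [hg.eq_integral 1, ← integral_smul_const]
    simp [smul_smul]
  simp_rw [h1]
  rw [h2]
  refine tendsto_integral_of_dominated_convergence
    (fun t => K * (Real.exp (c * |t| ^ γ) * ‖g t‖) * ‖x‖) (fun n => ?_)
    (((hg.integrable c).const_mul K).mul_const _) (fun n => .of_forall fun t => ?_)
    (.of_forall fun t => ?_)
  · exact hg.aestronglyMeasurable.smul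
      ((continuous_exp_smul (E n)).mul continuous_const).aestronglyMeasurable
  · rw [norm_smul]
    calc ‖g t‖ * ‖exp (((2 * Real.pi * t : ℝ) * Complex.I) • E n) * x‖
        ≤ ‖g t‖ * ((K * Real.exp (c * |t| ^ γ)) * ‖x‖) := by
          gcongr
          exact (norm_mul_le _ _).trans (by gcongr; exact hK _ (hE n) (hM n) t)
      _ = _ := by ring
  · refine Tendsto.const_smul ?_ (g t)
    set z : ℂ := (2 * Real.pi * t : ℝ) * Complex.I with hz
    have h3 : ∀ n, exp (z • E n) * x =
        Complex.exp z • (exp (z • (E n - 1)) * x) := fun n => by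
      have : z • E n = z • (1 : A) + z • (E n - 1) := by rw [smul_sub]; abel
      rw [this, exp_add_of_commute ((Commute.one_left _).smul_left z), mul_assoc]
      have h4 : exp (z • (1 : A)) = Complex.exp z • (1 : A) := by
        rw [← Algebra.algebraMap_eq_smul_one, ← Algebra.algebraMap_eq_smul_one,
          Complex.exp_eq_exp_ℂ, algebraMap_exp_comm]
      rw [h4, smul_one_mul]
    simp_rw [h3]
    refine Tendsto.const_smul ?_ _
    rw [tendsto_iff_norm_sub_tendsto_zero]
    have h5 : Tendsto (fun n => Real.exp (‖z‖ * (M + ‖(1 : A)‖)) * (‖z‖ * ‖E n * x - x‖)) atTop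
        (𝓝 0) := by
      simpa using ((tendsto_iff_norm_sub_tendsto_zero.1 hx).const_mul ‖z‖).const_mul
        (Real.exp (‖z‖ * (M + ‖(1 : A)‖)))
    refine squeeze_zero (fun _ => norm_nonneg _) (fun n => ?_) h5
    refine (norm_exp_mul_sub_le _ _).trans ?_
    rw [smul_mul_assoc, norm_smul, norm_smul, sub_mul, one_mul]
    gcongr
    exact (norm_sub_le _ _).trans (by gcongr; exact hM n)

end Calculus

section ContinuityIdeal

variable {A X : Type*} [NormedRing A] [NormedAlgebra ℂ A] [CompleteSpace A]
  [NormedAddCommGroup X] [NormedSpace ℂ X]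

lemma exists_norm_le_and_le_norm_map {E F : Type*} [NormedAddCommGroup E] [NormedSpace ℂ E]
    [NormedAddCommGroup F] [NormedSpace ℂ F] {f : E →ₗ[ℂ] F} (hf : ¬ Continuous f) {ε : ℝ}
    (hε : 0 < ε) (c : ℝ) : ∃ b, ‖b‖ ≤ ε ∧ c ≤ ‖f b‖ := by
  by_contra! h
  obtain ⟨D, hD⟩ := f.bound_of_ball_bound hε c fun z hz =>
    (h z (by simpa using (Metric.mem_ball.1 hz).le)).le
  exact hf (f.mkContinuous D hD).continuous

lemma exists_bound_of_continuous {E F : Type*} [NormedAddCommGroup E] [NormedSpace ℂ E]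
    [NormedAddCommGroup F] [NormedSpace ℂ F] {f : E →ₗ[ℂ] F} (hf : Continuous f) :
    ∃ D, 0 ≤ D ∧ ∀ b, ‖f b‖ ≤ D * ‖b‖ :=
  ⟨‖(⟨f, hf⟩ : E →L[ℂ] F)‖, norm_nonneg _, fun b => ContinuousLinearMap.le_opNorm ⟨f, hf⟩ b⟩

/-- The left continuity ideal of a linear map into a left module. -/
def continuityIdeal (L : A →ₗ[ℂ] X →ₗ[ℂ] X) (θ : A →ₗ[ℂ] X) : Submodule ℂ A where
  carrier := {a | Continuous fun b => L a (θ b)}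
  add_mem' := fun {a b} ha hb => by simpa using! Continuous.add ha hb
  zero_mem' := by simpa using continuous_const
  smul_mem' := fun c a ha => by simpa using! Continuous.const_smul ha c

variable {L : A →ₗ[ℂ] X →ₗ[ℂ] X} {θ : A →ₗ[ℂ] X} {K : ℝ}

lemma mem_continuityIdeal {a : A} :
    a ∈ continuityIdeal L θ ↔ Continuous fun b => L a (θ b) := Iff.rfl

lemma mem_continuityIdeal_iff_continuous_map_mul
    (hθ : ∀ a : A, Continuous fun b : A => θ (a * b) - L a (θ b)) {a : A} :
    a ∈ continuityIdeal L θ ↔ Continuous fun b => θ (a * b) := by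
  rw [mem_continuityIdeal]
  exact ⟨fun h => ((hθ a).add h).congr fun b => by simp,
    fun h => (h.sub (hθ a)).congr fun b => by simp⟩

lemma isClosed_continuityIdeal [CompleteSpace X]
    (hLK : ∀ (a : A) (x : X), ‖L a x‖ ≤ K * ‖a‖ * ‖x‖) :
    IsClosed (continuityIdeal L θ : Set A) := by
  refine isClosed_of_closure_subset fun a ha => ?_
  obtain ⟨u, hu, hua⟩ := mem_closure_iff_seq_limit.1 ha
  let T : ℕ → A →L[ℂ] X := fun n => ⟨(L (u n)).comp θ, hu n⟩
  have hT : Tendsto (fun n b => T n b) atTop (𝓝 fun b => L a (θ b)) := by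
    refine tendsto_pi_nhds.2 fun b => ?_
    let S : A →L[ℂ] X := (L.flip (θ b)).mkContinuous (K * ‖θ b‖) fun c =>
      (hLK c (θ b)).trans_eq (by ring)
    exact (S.continuous.tendsto a).comp hua
  exact (continuousLinearMapOfTendsto T hT).continuous

lemma continuityIdeal_mul_mem (hL : ∀ (a b : A) (x : X), L (a * b) x = L a (L b x))
    (hLK : ∀ (a : A) (x : X), ‖L a x‖ ≤ K * ‖a‖ * ‖x‖)
    (hθ : ∀ a : A, Continuous fun b : A => θ (a * b) - L a (θ b)) (a x : A)
    (hx : x ∈ continuityIdeal L θ) :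
    a * x ∈ continuityIdeal L θ ∧ x * a ∈ continuityIdeal L θ := by
  have hc : ∀ a, Continuous (L a) := fun a => ((L a).mkContinuous (K * ‖a‖) (hLK a)).continuous
  simp only [mem_continuityIdeal] at hx ⊢
  constructor
  · simp only [hL]
    exact (hc a).comp hx
  · have h1 := (hx.comp (continuous_const_mul a)).sub ((hc x).comp (hθ a))
    convert h1 using 2 with b
    simp [hL]

/-- Among pairwise orthogonal elements, some square lies in the continuity ideal. -/
lemma exists_mul_self_mem_continuityIdeal (hK : 0 ≤ K)
    (hLK : ∀ (a : A) (x : X), ‖L a x‖ ≤ K * ‖a‖ * ‖x‖)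
    (hθ : ∀ a : A, Continuous fun b : A => θ (a * b) - L a (θ b)) {a : ℕ → A}
    (ha : ∀ n m, n ≠ m → a n * a m = 0) : ∃ n, a n * a n ∈ continuityIdeal L θ := by
  by_contra! hcon
  have hD : ∀ n, ∃ D, 0 ≤ D ∧ ∀ b, ‖θ (a n * b) - L (a n) (θ b)‖ ≤ D * ‖b‖ := fun n =>
    exists_bound_of_continuous
      (f := θ.comp (LinearMap.mulLeft ℂ (a n)) - (L (a n)).comp θ) (hθ (a n))
  choose D hD0 hD using hD
  have hb : ∀ n, ∃ b, ‖b‖ ≤ (1 / 2) ^ n / (‖a n‖ + 1) ∧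
      n * (K * ‖a n‖ + 1) + D n * 2 ≤ ‖θ (a n * a n * b)‖ := fun n => by
    refine exists_norm_le_and_le_norm_map
      (f := θ.comp (LinearMap.mulLeft ℂ (a n * a n))) (fun h => hcon n ?_) (by positivity) _
    exact (mem_continuityIdeal_iff_continuous_map_mul hθ).2 h
  choose b hb1 hb2 using hb
  have hle : ∀ n, ‖a n * b n‖ ≤ (1 / 2) ^ n := fun n => by
    refine (norm_mul_le _ _).trans ?_
    calc ‖a n‖ * ‖b n‖ ≤ (‖a n‖ + 1) * ((1 / 2) ^ n / (‖a n‖ + 1)) := by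
          gcongr
          · linarith
          · exact hb1 n
      _ = (1 / 2) ^ n := by field_simp
  have hsum : Summable fun n => a n * b n :=
    Summable.of_norm_bounded summable_geometric_two hle
  set y := ∑' n, a n * b n with hy
  have hy2 : ‖y‖ ≤ 2 := tsum_of_norm_bounded hasSum_geometric_two hle
  have hay : ∀ n, a n * y = a n * a n * b n := fun n => by
    rw [hy, ← hsum.tsum_mul_left, tsum_eq_single n, mul_assoc]
    intro m hm
    rw [← mul_assoc, ha n m hm.symm, zero_mul]
  obtain ⟨n, hn⟩ := exists_nat_gt ‖θ y‖
  have h1 := hb2 n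
  rw [← hay] at h1
  have h2 : ‖θ (a n * y)‖ ≤ K * ‖a n‖ * ‖θ y‖ + D n * 2 := by
    have h3 := norm_le_norm_add_norm_sub' (θ (a n * y)) (L (a n) (θ y))
    have h4 := hD n y
    have h5 := mul_le_mul_of_nonneg_left hy2 (hD0 n)
    linarith [hLK (a n) (θ y)]
  have h6 : 0 ≤ K * ‖a n‖ := by positivity
  nlinarith [norm_nonneg (θ y)]

end ContinuityIdeal

section Factorization

variable {A : Type*} [NormedRing A] [NormedAlgebra ℂ A] [CompleteSpace A]

lemma exists_units_near {I : Submodule ℂ A}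
    {J : Type*} {F : Filter J} [F.NeBot] {e : J → A} {M : ℝ} (hM : ∀ j, ‖e j‖ ≤ M)
    (heI : ∀ x ∈ I, Tendsto (fun j => e j * x) F (𝓝 x)) {x : ℕ → A} (hxI : ∀ n, x n ∈ I)
    (hx : Tendsto x atTop (𝓝 0)) {c : ℝ} (hc : 0 < c) (hcM : c * (M + ‖(1 : A)‖) ≤ 1 / 2)
    (t : Aˣ) {κ : ℝ} (ht : (t : A) - (κ : ℂ) • 1 ∈ I) {ε : ℝ} (hε : 0 < ε) :
    ∃ (t' : Aˣ) (j : J), (t' : A) = t + ((c * κ : ℝ) : ℂ) • (e j - 1) ∧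
      ∀ n, ‖(↑t'⁻¹ : A) * x n - (↑t⁻¹ : A) * x n‖ ≤ ε := by
  set N := ‖(1 : A)‖ + 1
  have hsmall : ∀ j, ‖(c : ℂ) • (1 - e j)‖ ≤ 1 / 2 := fun j => by
    rw [norm_smul, Complex.norm_real, Real.norm_of_nonneg hc.le]
    refine le_trans ?_ hcM
    gcongr
    linarith [norm_sub_le (1 : A) (e j), hM j]
  set E : J → Aˣ := fun j => Units.oneSub ((c : ℂ) • (1 - e j)) ((hsmall j).trans_lt (by norm_num))
  have hEval : ∀ j, ((E j : Aˣ) : A) = 1 - (c : ℂ) • (1 - e j) := fun j => rfl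
  have hEinv : ∀ j, ‖(↑(E j)⁻¹ : A)‖ ≤ N := fun j => by
    have h1 := tsum_geometric_le_of_norm_lt_one ((c : ℂ) • (1 - e j))
      ((hsmall j).trans_lt (by norm_num))
    have h2 : (1 - ‖(c : ℂ) • (1 - e j)‖)⁻¹ ≤ (1 / 2 : ℝ)⁻¹ := by
      gcongr
      linarith [hsmall j]
    have h3 : (↑(E j)⁻¹ : A) = ∑' n : ℕ, ((c : ℂ) • (1 - e j)) ^ n := rfl
    rw [h3]
    rw [one_div, inv_inv] at h2
    simp only [N]
    linarith
  have hElim : ∀ y ∈ I, Tendsto (fun j => (↑(E j)⁻¹ : A) * y) F (𝓝 y) := fun y hy => by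
    rw [tendsto_iff_norm_sub_tendsto_zero]
    have h1 : Tendsto (fun j => N * (c * ‖e j * y - y‖)) F (𝓝 0) := by
      simpa using ((tendsto_iff_norm_sub_tendsto_zero.1 (heI y hy)).const_mul c).const_mul N
    refine squeeze_zero (fun _ => norm_nonneg _) (fun j => ?_) h1
    have h2 : (↑(E j)⁻¹ : A) * y - y = (↑(E j)⁻¹ : A) * -((c : ℂ) • (e j * y - y)) := by
      have h3 : -((c : ℂ) • (e j * y - y)) = y - (E j : A) * y := by
        rw [hEval, sub_mul, smul_mul_assoc, sub_mul, one_mul, ← smul_neg]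
        simp
      rw [h3, mul_sub, Units.inv_mul_cancel_left]
    rw [h2]
    refine (norm_mul_le _ _).trans ?_
    rw [norm_neg, norm_smul, Complex.norm_real, Real.norm_of_nonneg hc.le]
    gcongr
    exact hEinv j
  set w : J → A := fun j => (κ : ℂ) • 1 + (↑(E j)⁻¹ : A) * ((t : A) - (κ : ℂ) • 1)
  have hw : Tendsto w F (𝓝 (t : A)) := by
    have := (hElim _ ht).const_add ((κ : ℂ) • (1 : A))
    simpa [w] using this
  have hwinv : Tendsto (fun j => Ring.inverse (w j)) F (𝓝 (↑t⁻¹ : A)) := by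
    have := (NormedRing.inverse_continuousAt t).tendsto.comp hw
    simpa using! this
  have hwunit : ∀ᶠ j in F, IsUnit (w j) := hw.eventually (Units.isOpen.mem_nhds t.isUnit)
  have hwb : ∀ᶠ j in F, ‖Ring.inverse (w j)‖ ≤ ‖(↑t⁻¹ : A)‖ + 1 :=
    hwinv.norm.eventually (eventually_le_nhds (by linarith))
  have hlim : ∀ n, ∀ᶠ j in F,
      ‖Ring.inverse (w j) * ((↑(E j)⁻¹ : A) * x n) - (↑t⁻¹ : A) * x n‖ ≤ ε := fun n =>
    (tendsto_iff_norm_sub_tendsto_zero.1 (hwinv.mul (hElim _ (hxI n)))).eventually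
      (eventually_le_nhds hε)
  set Q := (‖(↑t⁻¹ : A)‖ + 1) * N + ‖(↑t⁻¹ : A)‖
  have htail : ∀ᶠ n in atTop, Q * ‖x n‖ ≤ ε := by
    have : Tendsto (fun n => Q * ‖x n‖) atTop (𝓝 0) := by simpa using hx.norm.const_mul Q
    exact this.eventually (eventually_le_nhds hε)
  obtain ⟨n₀, hn₀⟩ := eventually_atTop.1 htail
  have hfin : ∀ᶠ j in F, ∀ n ∈ Finset.range n₀,
      ‖Ring.inverse (w j) * ((↑(E j)⁻¹ : A) * x n) - (↑t⁻¹ : A) * x n‖ ≤ ε :=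
    (Filter.eventually_all_finset _).2 fun n _ => hlim n
  obtain ⟨j, hj1, hj2, hj3⟩ := (hwunit.and (hwb.and hfin)).exists
  refine ⟨E j * hj1.unit, j, ?_, fun n => ?_⟩
  · rw [Units.val_mul, IsUnit.unit_spec]
    simp only [w]
    rw [mul_add, Units.mul_inv_cancel_left, mul_smul_comm, mul_one, hEval, smul_sub, smul_smul,
      Complex.ofReal_mul, mul_comm (κ : ℂ), ← neg_sub (e j) 1, smul_neg]
    abel
  · have hinv : (↑(E j * hj1.unit)⁻¹ : A) * x n =
        Ring.inverse (w j) * ((↑(E j)⁻¹ : A) * x n) := by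
      rw [mul_inv_rev, Units.val_mul, mul_assoc]
      congr 1
      rw [← Ring.inverse_unit, IsUnit.unit_spec]
    rw [hinv]
    by_cases hn : n < n₀
    · exact hj3 n (Finset.mem_range.2 hn)
    · refine le_trans ?_ (hn₀ n (not_lt.1 hn))
      have h1 : ‖Ring.inverse (w j) * ((↑(E j)⁻¹ : A) * x n)‖ ≤
          (‖(↑t⁻¹ : A)‖ + 1) * (N * ‖x n‖) :=
        (norm_mul_le _ _).trans (by
          gcongr
          exact (norm_mul_le _ _).trans (by gcongr; exact hEinv j))
      have h2 := norm_mul_le (↑t⁻¹ : A) (x n)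
      refine (norm_sub_le _ _).trans ?_
      simp only [Q]
      linarith

/-- Cohen factorization of a null sequence. -/
lemma exists_factorization {I : Submodule ℂ A} (hI : IsClosed (I : Set A))
    {J : Type*} {F : Filter J} [F.NeBot] {e : J → A} (he : ∀ j, e j ∈ I) {M : ℝ}
    (hM : ∀ j, ‖e j‖ ≤ M)
    (heI : ∀ x ∈ I, Tendsto (fun j => e j * x) F (𝓝 x)) {x : ℕ → A} (hxI : ∀ n, x n ∈ I)
    (hx : Tendsto x atTop (𝓝 0)) :
    ∃ a ∈ I, ∃ z : ℕ → A, (∀ n, ‖z n‖ ≤ ‖x n‖ + 2) ∧ ∀ n, x n = a * z n := by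
  obtain ⟨j₀⟩ : Nonempty J := F.nonempty_of_neBot
  have hM0 : 0 ≤ M := (norm_nonneg _).trans (hM j₀)
  set c : ℝ := 1 / (2 * (M + ‖(1 : A)‖ + 1)) with hc
  have hc0 : 0 < c := by positivity
  have hcM : c * (M + ‖(1 : A)‖) ≤ 1 / 2 := by
    rw [hc, div_mul_eq_mul_div, div_le_div_iff₀ (by positivity) (by norm_num)]; linarith
  have hc1 : c < 1 := by
    rw [hc, div_lt_one (by positivity)]; linarith [norm_nonneg (1 : A)]
  let S := {t : ℕ × Aˣ // (t.2 : A) - (((1 - c) ^ t.1 : ℝ) : ℂ) • 1 ∈ I}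
  have hstep : ∀ s : S, ∃ s' : S, s'.1.1 = s.1.1 + 1 ∧
      ‖(s'.1.2 : A) - s.1.2‖ ≤ (1 - c) ^ s.1.1 * (M + ‖(1 : A)‖) ∧
      ∀ n, ‖(↑s'.1.2⁻¹ : A) * x n - (↑s.1.2⁻¹ : A) * x n‖ ≤ (1 / 2) ^ s.1.1 := by
    rintro ⟨⟨m, t⟩, ht⟩
    obtain ⟨t', j, ht', hn⟩ := exists_units_near hM heI hxI hx hc0 hcM t ht
      (ε := (1 / 2) ^ m) (by positivity)
    refine ⟨⟨⟨m + 1, t'⟩, ?_⟩, rfl, ?_, hn⟩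
    · have : (t' : A) - (((1 - c) ^ (m + 1) : ℝ) : ℂ) • 1 =
          ((t : A) - (((1 - c) ^ m : ℝ) : ℂ) • 1) + ((c * (1 - c) ^ m : ℝ) : ℂ) • e j := by
        have h2 : ((1 - c) ^ (m + 1) : ℝ) = (1 - c) ^ m - c * (1 - c) ^ m := by ring
        rw [ht', h2, Complex.ofReal_sub, sub_smul, smul_sub]
        abel
      rw [this]
      exact I.add_mem ht (I.smul_mem _ (he j))
    · have h1 : 0 ≤ (1 - c) ^ m := pow_nonneg (by linarith) m
      simp only [ht', add_sub_cancel_left]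
      rw [norm_smul, Complex.norm_real, Real.norm_of_nonneg (by positivity)]
      refine mul_le_mul (mul_le_of_le_one_left h1 hc1.le) ?_ (norm_nonneg _) h1
      exact (norm_sub_le _ _).trans (by gcongr; exact hM j)
  choose next hnext1 hnext2 hnext3 using hstep
  let s : ℕ → S := fun m => next^[m] ⟨⟨0, 1⟩, by simp⟩
  have hs : ∀ m, s (m + 1) = next (s m) := fun m => Function.iterate_succ_apply' _ _ _
  have hidx : ∀ m, (s m).1.1 = m := fun m => by
    induction m with
    | zero => rfl
    | succ m ih => rw [hs, hnext1, ih]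
  set t : ℕ → Aˣ := fun m => (s m).1.2
  have ht0 : t 0 = 1 := rfl
  have htI : ∀ m, (t m : A) - (((1 - c) ^ m : ℝ) : ℂ) • 1 ∈ I := fun m => by
    have := (s m).2
    rwa [hidx] at this
  have htdist : ∀ m, dist (t m : A) (t (m + 1)) ≤ (M + ‖(1 : A)‖) * (1 - c) ^ m := fun m => by
    rw [dist_comm, dist_eq_norm, mul_comm]
    have := hnext2 (s m)
    rwa [← hs, hidx] at this
  have hzdist : ∀ n m, dist ((↑(t m)⁻¹ : A) * x n) ((↑(t (m + 1))⁻¹ : A) * x n) ≤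
      2 / 2 / 2 ^ m := fun n m => by
    rw [dist_comm, dist_eq_norm]
    have := hnext3 (s m) n
    rw [← hs, hidx] at this
    refine this.trans_eq ?_
    rw [one_div_pow]; norm_num
  obtain ⟨a, ha⟩ := cauchySeq_tendsto_of_complete
    (cauchySeq_of_le_geometric (1 - c) _ (by linarith) htdist)
  choose z hz using fun n => cauchySeq_tendsto_of_complete
    (cauchySeq_of_le_geometric_two (hzdist n))
  refine ⟨a, ?_, z, fun n => ?_, fun n => ?_⟩
  · have hpow : Tendsto (fun m : ℕ => ((((1 - c) ^ m : ℝ) : ℂ)) • (1 : A)) atTop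
        (𝓝 ((0 : ℂ) • (1 : A))) := by
      refine Tendsto.smul_const ?_ _
      have := tendsto_pow_atTop_nhds_zero_of_lt_one (r := 1 - c) (by linarith) (by linarith)
      exact_mod_cast (Complex.continuous_ofReal.tendsto 0).comp this
    have h1 := ha.sub hpow
    rw [zero_smul, sub_zero] at h1
    exact hI.mem_of_tendsto h1 (.of_forall htI)
  · have h1 := dist_le_of_le_geometric_two_of_tendsto₀ (hzdist n) (hz n)
    rw [ht0, inv_one, Units.val_one, one_mul, dist_eq_norm] at h1
    have h2 := norm_le_norm_add_norm_sub (z n) (x n)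
    rw [norm_sub_rev] at h2
    linarith [norm_le_norm_add_norm_sub (x n) (z n)]
  · refine tendsto_nhds_unique (tendsto_const_nhds.congr fun m => ?_) (ha.mul (hz n))
    rw [Units.mul_inv_cancel_left]

lemma continuous_of_le_continuityIdeal {X : Type*} [NormedAddCommGroup X] [NormedSpace ℂ X]
    {L : A →ₗ[ℂ] X →ₗ[ℂ] X} {θ : A →ₗ[ℂ] X}
    (hθ : ∀ a : A, Continuous fun b : A => θ (a * b) - L a (θ b))
    {I : Submodule ℂ A} (hI : IsClosed (I : Set A))
    (hIle : I ≤ continuityIdeal L θ) (hfin : FiniteDimensional ℂ (A ⧸ I))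
    {J : Type*} {F : Filter J} [F.NeBot] {e : J → A} (he : ∀ j, e j ∈ I) {M : ℝ}
    (hM : ∀ j, ‖e j‖ ≤ M)
    (heI : ∀ x ∈ I, Tendsto (fun j => e j * x) F (𝓝 x)) : Continuous θ := by
  have hres : Continuous (θ.comp I.subtype) := by
    by_contra hcon
    choose x hx1 hx2 using fun n : ℕ =>
      exists_norm_le_and_le_norm_map hcon (ε := 1 / ((n : ℝ) + 1)) (by positivity) n
    have hx0 : Tendsto (fun n => (x n : A)) atTop (𝓝 0) :=
      squeeze_zero_norm hx1 tendsto_one_div_add_atTop_nhds_zero_nat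
    obtain ⟨a, haI, z, hz, hxz⟩ := exists_factorization hI he hM heI (fun n => (x n).2) hx0
    obtain ⟨D, hD0, hD⟩ := exists_bound_of_continuous (f := θ.comp (LinearMap.mulLeft ℂ a))
      ((mem_continuityIdeal_iff_continuous_map_mul hθ).1 (hIle haI))
    obtain ⟨n, hn⟩ := exists_nat_gt (D * 3)
    have h1 : ‖(x n : A)‖ ≤ 1 :=
      (hx1 n).trans ((div_le_one (by positivity)).2 (by linarith [Nat.cast_nonneg (α := ℝ) n]))
    have h2 : ‖θ (x n)‖ ≤ D * 3 := by
      rw [hxz n]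
      exact (hD (z n)).trans (by gcongr; linarith [hz n])
    have h3 : (n : ℝ) ≤ ‖θ (x n)‖ := hx2 n
    linarith
  obtain ⟨P, hP⟩ := Submodule.ClosedComplemented.of_finiteDimensional_quotient (𝕜 := ℂ) (p := I) hI
  set T : A →ₗ[ℂ] X := θ - (θ.comp I.subtype).comp P.toLinearMap with hT
  have hTI : I ≤ LinearMap.ker T := fun x hx => by
    have := hP ⟨x, hx⟩
    simp only [LinearMap.mem_ker, hT, LinearMap.sub_apply, LinearMap.comp_apply]
    erw [this]
    simp
  have hTc : Continuous T := by
    have h1 : Continuous (I.liftQ T hTI) := LinearMap.continuous_of_finiteDimensional _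
    exact h1.comp I.mkQL.continuous
  have : (θ : A → X) = fun a => T a + (θ.comp I.subtype) (P a) := by
    ext a; simp [hT]
  rw [this]
  exact hTc.add (hres.comp P.continuous)

end Factorization

section RelClosure

variable {A B : Type*} [NormedRing A] [StarRing A] [NormedAlgebra ℂ A] [CompleteSpace A]
  [CStarAlgebra B] {ι : A →⋆ₙₐ[ℂ] B}

/-- The elements of `A` whose image under `ι` lies in the closure of the image of `I`. -/
noncomputable def relClosure (ι : A →⋆ₙₐ[ℂ] B) (I : Submodule ℂ A) : Submodule ℂ A :=
  ((I.map (ι : A →ₗ[ℂ] B)).topologicalClosure).comap (ι : A →ₗ[ℂ] B)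

variable {I : Submodule ℂ A}

lemma mem_relClosure {a : A} :
    a ∈ relClosure ι I ↔ ∀ ε > 0, ∃ y ∈ I, ‖ι (a - y)‖ < ε := by
  rw [relClosure, Submodule.mem_comap, ← SetLike.mem_coe, Submodule.topologicalClosure_coe,
    Metric.mem_closure_iff]
  simp [dist_eq_norm]

lemma isClosed_relClosure (hι : Continuous ι) : IsClosed (relClosure ι I : Set A) :=
  (Submodule.isClosed_topologicalClosure _).preimage hι

lemma relClosure_mul_mem (hI2 : ∀ a x : A, x ∈ I → a * x ∈ I ∧ x * a ∈ I) (a x : A)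
    (hx : x ∈ relClosure ι I) : a * x ∈ relClosure ι I ∧ x * a ∈ relClosure ι I := by
  have key : ∀ ε > 0, ∃ y ∈ I, ‖ι a‖ * ‖ι (x - y)‖ < ε := fun ε hε => by
    obtain ⟨y, hy, hxy⟩ := mem_relClosure.1 hx (ε / (‖ι a‖ + 1)) (by positivity)
    rw [lt_div_iff₀ (by positivity)] at hxy
    exact ⟨y, hy, by nlinarith [norm_nonneg (ι (x - y))]⟩
  refine ⟨mem_relClosure.2 fun ε hε => ?_, mem_relClosure.2 fun ε hε => ?_⟩ <;>
    obtain ⟨y, hy, hxy⟩ := key ε hε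
  · refine ⟨a * y, (hI2 a y hy).1, lt_of_le_of_lt ?_ hxy⟩
    rw [← mul_sub, map_mul]
    exact norm_mul_le _ _
  · refine ⟨y * a, (hI2 a y hy).2, lt_of_le_of_lt ?_ hxy⟩
    rw [← sub_mul, map_mul, mul_comm]
    exact norm_mul_le _ _

lemma star_mem_relClosure (hIs : ∀ x ∈ I, star x ∈ I) {x : A} (hx : x ∈ relClosure ι I) :
    star x ∈ relClosure ι I := mem_relClosure.2 fun ε hε => by
  obtain ⟨y, hy, hxy⟩ := mem_relClosure.1 hx ε hε
  exact ⟨star y, hIs y hy, by rwa [← star_sub, map_star, norm_star]⟩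

variable {γ : ℝ}

/-- The points at which no plateau function of `h` belongs to `I`. -/
def essentialPoints (γ : ℝ) (I : Submodule ℂ A) (h : A) : Set ℝ :=
  {x₀ | ∀ r R φ g, 0 < r → IsFourierPlateau γ x₀ r R φ g → fourierCalc g h ∉ I}

lemma finite_essentialPoints (hγ : 0 < γ) (hγ1 : γ < 1) (hA : HasExpGrowth A γ)
    (hι : Continuous ι) (hinj : Function.Injective ι)
    (hI2 : ∀ a x : A, x ∈ I → a * x ∈ I ∧ x * a ∈ I)
    (horth : ∀ a : ℕ → A, (∀ n, IsSelfAdjoint (a n)) → (∀ n m, n ≠ m → a n * a m = 0) →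
      ∃ n, a n * a n ∈ I) {h : A} (hh : IsSelfAdjoint h) : (essentialPoints γ I h).Finite := by
  by_contra hinf
  have : Infinite (essentialPoints γ I h) := Set.infinite_coe_iff.2 hinf
  obtain ⟨U, hUi, hUo, hUd⟩ := exists_seq_infinite_isOpen_pairwise_disjoint (essentialPoints γ I h)
  have hpt : ∀ n, ∃ x : essentialPoints γ I h, x ∈ U n := fun n =>
    (hUi n).nonempty
  choose x hx using hpt
  have hball : ∀ n, ∃ d > 0, Metric.ball (x n) d ⊆ U n := fun n =>
    Metric.isOpen_iff.1 (hUo n) _ (hx n)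
  choose d hd hdU using hball
  have hdist : ∀ n m, n ≠ m → d n ≤ |(x m : ℝ) - x n| := fun n m hnm => by
    by_contra! hlt
    exact Set.disjoint_left.1 (hUd hnm) (hdU n (by
      rwa [Metric.mem_ball, Subtype.dist_eq, Real.dist_eq])) (hx m)
  choose φ g hg using fun n => exists_isFourierPlateau hγ hγ1 (x n : ℝ) (r := d n / 4)
    (R := d n / 2) (by linarith [hd n]) (by linarith [hd n])
  choose φ' g' hg' using fun n => exists_isFourierPlateau hγ hγ1 (x n : ℝ) (r := d n / 8)
    (R := d n / 4) (by linarith [hd n]) (by linarith [hd n])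
  have hrep := fun n => (hg n).represents hA hι hh
  obtain ⟨n, hn⟩ := horth (fun n => fourierCalc (g n) h)
    (fun n => (hrep n).isSelfAdjoint hinj) fun n m hnm => by
      refine ((hrep n).mul (hrep m)).eq_of_eqOn hinj
        ((Represents.one hh).sub (Represents.one hh) : Represents ι h _ (1 - 1)) ?_ |>.trans
        (sub_self 1)
      intro y _
      simp only [sub_self]
      by_cases hy : d n / 2 ≤ |y - x n|
      · rw [(hg n).eq_zero y hy, zero_mul]
      · rw [(hg m).eq_zero y, mul_zero]
        have h1 := hdist n m hnm
        have h2 := hdist m n hnm.symm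
        rw [abs_sub_comm] at h2
        have h3 := abs_sub_le (x m : ℝ) y (x n)
        rw [abs_sub_comm (x m : ℝ) y] at h3
        linarith
  have h1 : fourierCalc (g' n) h = fourierCalc (g' n) h * (fourierCalc (g n) h *
      fourierCalc (g n) h) := by
    have h2 := (hg' n).represents hA hι hh
    refine h2.eq_of_eqOn hinj (h2.mul ((hrep n).mul (hrep n))) fun y _ => ?_
    by_cases hy : |y - x n| ≤ d n / 4
    · simp [(hg n).eq_one y hy]
    · simp [(hg' n).eq_zero y (not_le.1 hy).le]
  refine (x n).2 _ _ _ _ (by linarith [hd n]) (hg' n) ?_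
  rw [h1]
  exact (hI2 _ _ hn).1

open Polynomial in
/-- Every self-adjoint element satisfies a polynomial with simple real roots modulo
`relClosure ι I`. -/
lemma exists_aeval_mem_relClosure (hγ : 0 < γ) (hγ1 : γ < 1) (hA : HasExpGrowth A γ)
    (hι : Continuous ι) (hinj : Function.Injective ι)
    (hI2 : ∀ a x : A, x ∈ I → a * x ∈ I ∧ x * a ∈ I)
    (horth : ∀ a : ℕ → A, (∀ n, IsSelfAdjoint (a n)) → (∀ n m, n ≠ m → a n * a m = 0) →
      ∃ n, a n * a n ∈ I) {h : A} (hh : IsSelfAdjoint h) :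
    ∃ s : Finset ℝ, aeval h (∏ i ∈ s, (X - C (i : ℂ))) ∈ relClosure ι I := by
  classical
  set s := (finite_essentialPoints hγ hγ1 hA hι hinj hI2 horth hh).toFinset with hs
  refine ⟨s, mem_relClosure.2 fun ε hε => ?_⟩
  have hz : ∀ s : Finset ℝ, Represents ι h (fun x => ∏ i ∈ s, (x - i))
      (aeval h (∏ i ∈ s, (X - C (i : ℂ)))) := fun s => by
    induction s using Finset.induction_on with
    | empty => simpa using Represents.one hh
    | insert i s hi ih =>
      have h1 : Represents ι h (fun x => x - i) (aeval h (X - C (i : ℂ))) := by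
        simpa [Algebra.algebraMap_eq_smul_one] using
          (Represents.self hh).sub ((Represents.one hh).const_smul i)
      simpa [Finset.prod_insert hi] using h1.mul ih
  set z := aeval h (∏ i ∈ s, (X - C (i : ℂ)))
  have hR : ∀ i ∈ s, ∃ d > 0, ∀ x, |x - i| < d → |∏ i ∈ s, (x - i)| < ε / 2 := fun i hi => by
    have h1 := Metric.continuousAt_iff.1 ((hz s).continuous.continuousAt (x := i)) (ε / 2)
      (by positivity)
    rw [Finset.prod_eq_zero hi (sub_self i)] at h1
    simpa [Real.dist_eq, Finset.abs_prod] using h1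
  have hpl : ∀ i, ∃ r R φ g, 0 < r ∧ IsFourierPlateau γ i r R φ g ∧
      (i ∈ s → ∀ x, |x - i| < R → |∏ i ∈ s, (x - i)| < ε / 2) ∧
      (i ∉ s → fourierCalc g h ∈ I) := fun i => by
    by_cases hi : i ∈ s
    · obtain ⟨d, hd, hx⟩ := hR i hi
      obtain ⟨φ, g, hg⟩ := exists_isFourierPlateau hγ hγ1 i (half_pos hd) (half_lt_self hd)
      exact ⟨_, _, φ, g, half_pos hd, hg, fun _ => hx, fun h => absurd hi h⟩
    · have h1 : i ∉ essentialPoints γ I h := by simpa [hs] using hi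
      simp only [essentialPoints, Set.mem_ofPred_eq, not_forall, not_not] at h1
      obtain ⟨r, R, φ, g, hr, hg, hmem⟩ := h1
      exact ⟨r, R, φ, g, hr, hg, fun h => absurd h hi, fun _ => hmem⟩
  choose r R φ g hr hg hsmall hmem using hpl
  obtain ⟨t, ht⟩ := (isCompact_Icc (a := -‖ι h‖) (b := ‖ι h‖)).elim_finite_subcover
    (fun i => Metric.ball i (r i)) (fun _ => Metric.isOpen_ball)
    (fun x _ => Set.mem_iUnion.2 ⟨x, Metric.mem_ball_self (hr x)⟩)
  have hrep : ∀ i, Represents ι h (fun x => 1 - φ i x) (1 - fourierCalc (g i) h) := fun i =>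
    (Represents.one hh).sub ((hg i).represents hA hι hh)
  obtain ⟨y, hy, -⟩ := Represents.exists_prod (P := fun _ => True) (G := fun i x => 1 - φ i x)
    hh trivial (fun _ _ _ _ => trivial) s fun i _ => ⟨_, hrep i, trivial⟩
  obtain ⟨w, hw, hwI⟩ := Represents.exists_prod (P := fun a => 1 - a ∈ I)
    (G := fun i x => 1 - φ i x) hh (by simp)
    (fun a b ha hb => by
      have : 1 - a * b = (1 - a) + a * (1 - b) := by noncomm_ring
      rw [this]
      exact I.add_mem ha (hI2 _ _ hb).1) (t \ s) fun i hi =>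
    ⟨_, hrep i, by simpa using hmem i (Finset.mem_sdiff.1 hi).2⟩
  have hyw : y * w = 0 := by
    refine ((hy.mul hw).eq_of_eqOn hinj
      ((Represents.one hh).sub (Represents.one hh)) ?_).trans (sub_self 1)
    intro x hx
    have hxK := abs_le.1 (abs_le_norm_of_mem_spectrum hx)
    obtain ⟨i, hi⟩ := Set.mem_iUnion.1 (ht hxK)
    obtain ⟨hit, hi⟩ := Set.mem_iUnion.1 hi
    have h1 : 1 - φ i x = 0 := by
      rw [(hg i).eq_one x (by simpa [Real.dist_eq] using (Metric.mem_ball.1 hi).le), sub_self]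
    simp only [sub_self]
    by_cases his : i ∈ s
    · rw [Finset.prod_eq_zero his h1, zero_mul]
    · rw [Finset.prod_eq_zero (Finset.mem_sdiff.2 ⟨hit, his⟩) h1, mul_zero]
  have hyI : y ∈ I := by
    have : y = y * (1 - w) := by rw [mul_sub, hyw, mul_one, sub_zero]
    rw [this]
    exact (hI2 _ _ hwI).1
  refine ⟨z * y, (hI2 _ _ hyI).1, lt_of_le_of_lt
    (((hz s).sub ((hz s).mul hy)).norm_le (c := ε / 2) (by positivity) fun x _ => ?_)
    (half_lt_self hε)⟩
  by_cases hx : ∀ i ∈ s, φ i x = 0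
  · have : ∏ i ∈ s, (1 - φ i x) = 1 := Finset.prod_eq_one fun i hi => by rw [hx i hi, sub_zero]
    rw [this, mul_one, sub_self, abs_zero]
    positivity
  · push Not at hx
    obtain ⟨i, hi, hix⟩ := hx
    have h1 := hsmall i hi x (by
      by_contra hcon
      exact hix ((hg i).eq_zero x (not_lt.1 hcon)))
    have h2 : 0 ≤ ∏ i ∈ s, (1 - φ i x) :=
      Finset.prod_nonneg fun i _ => by linarith [(hg i).le_one x]
    have h3 : ∏ i ∈ s, (1 - φ i x) ≤ 1 :=
      Finset.prod_le_one (fun i _ => by linarith [(hg i).le_one x])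
        fun i _ => by linarith [(hg i).nonneg x]
    rw [← mul_one_sub, abs_mul]
    refine (mul_le_of_le_one_right (abs_nonneg _) ?_).trans h1.le
    rw [abs_le]
    constructor <;> linarith

variable [StarModule ℂ A]

lemma IsFourierPlateau.one_sub_fourierCalc_mem {r R : ℝ} {φ : ℝ → ℝ} {g : ℝ → ℂ}
    (hg : IsFourierPlateau γ 0 r R φ g) (hr : 0 < r) (hA : HasExpGrowth A γ)
    (hι : Continuous ι) (hinj : Function.Injective ι) (hI : IsClosed (I : Set A))
    (hI2 : ∀ a x : A, x ∈ I → a * x ∈ I ∧ x * a ∈ I) (hIs : ∀ x ∈ I, star x ∈ I)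
    {h : A} (hh : IsSelfAdjoint h) (hhI : h ∈ relClosure ι I) : 1 - fourierCalc g h ∈ I := by
  obtain ⟨y, hy, hhy⟩ := mem_relClosure.1 hhI r hr
  set v : A := (1 / 2 : ℂ) • (y + star y) with hv
  have hvI : v ∈ I := I.smul_mem _ (I.add_mem hy (hIs y hy))
  have hvs : IsSelfAdjoint v := by
    rw [IsSelfAdjoint, hv, star_smul, star_add, star_star, add_comm]
    simp
  have hk : IsSelfAdjoint (h - v) := hh.sub hvs
  have hnorm : ‖ι (h - v)‖ ≤ r := by
    have h1 : h - v = (1 / 2 : ℂ) • ((h - y) + star (h - y)) := by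
      rw [star_sub, hh.star_eq, hv, sub_add_sub_comm, smul_sub, ← two_smul ℂ h, smul_smul]
      norm_num
    rw [h1, map_smul, map_add, map_star, norm_smul]
    have h2 := norm_add_le (ι (h - y)) (star (ι (h - y)))
    rw [norm_star] at h2
    have h3 : ‖(1 / 2 : ℂ)‖ = 1 / 2 := by norm_num
    rw [h3]
    linarith
  have h1 : fourierCalc g (h - v) = 1 := by
    refine (hg.represents hA hι hk).eq_of_eqOn hinj (Represents.one hk) fun x hx => ?_
    exact hg.eq_one x (by simpa using (abs_le_norm_of_mem_spectrum hx).trans hnorm)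
  have h2 := hg.fourierCalc_sub_mem hA hI hI2 hk hh (by simpa using hvI)
  rwa [h1] at h2

lemma mem_relClosure_of_star_mul_self (hγ : 0 < γ) (hγ1 : γ < 1) (hA : HasExpGrowth A γ)
    (hι : Continuous ι) (hinj : Function.Injective ι) (hI : IsClosed (I : Set A))
    (hI2 : ∀ a x : A, x ∈ I → a * x ∈ I ∧ x * a ∈ I) (hIs : ∀ x ∈ I, star x ∈ I)
    {x : A} (hx : star x * x ∈ relClosure ι I) : x ∈ relClosure ι I := by
  refine mem_relClosure.2 fun ε hε => ?_
  have hR : 0 < (ε / 2) ^ 2 := by positivity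
  obtain ⟨φ, g, hg⟩ := exists_isFourierPlateau hγ hγ1 0 (half_pos hR) (half_lt_self hR)
  have hc : IsSelfAdjoint (star x * x) := .star_mul_self x
  have h1 := hg.one_sub_fourierCalc_mem (half_pos hR) hA hι hinj hI hI2 hIs hc hx
  refine ⟨_, (hI2 x _ h1).1, ?_⟩
  have hrep := hg.represents hA hι hc
  rw [mul_sub, mul_one, sub_sub_cancel]
  set y := fourierCalc g (star x * x)
  have h2 : ‖ι (x * y)‖ * ‖ι (x * y)‖ = ‖ι (y * ((star x * x) * y))‖ := by
    rw [← CStarRing.norm_star_mul_self, ← map_star, ← map_mul, star_mul,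
      (hrep.isSelfAdjoint hinj).star_eq]
    simp only [mul_assoc]
  have h3 : ‖ι (y * ((star x * x) * y))‖ ≤ (ε / 2) ^ 2 := by
    refine (hrep.mul ((Represents.self hc).mul hrep)).norm_le hR.le fun t _ => ?_
    by_cases ht : (ε / 2) ^ 2 ≤ |t - 0|
    · rw [hg.eq_zero t ht]; simp [hR.le]
    · rw [sub_zero, not_le] at ht
      have h4 : |φ t| ≤ 1 := abs_le.2 ⟨by linarith [hg.nonneg t], hg.le_one t⟩
      rw [abs_mul, abs_mul]
      calc |φ t| * (|t| * |φ t|) ≤ 1 * (|t| * 1) := by gcongr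
        _ ≤ _ := by linarith
  rw [← h2, ← pow_two] at h3
  exact (abs_le_of_sq_le_sq' h3 (by positivity)).2.trans_lt (half_lt_self hε)

lemma relClosure_le_of_approximate_identity (hstar : Continuous (star : A → A)) (hγ : 0 < γ)
    (hγ1 : γ < 1) (hA : HasExpGrowth A γ) (hι : Continuous ι) (hinj : Function.Injective ι)
    (hI : IsClosed (I : Set A)) (hI2 : ∀ a x : A, x ∈ I → a * x ∈ I ∧ x * a ∈ I)
    (hIs : ∀ x ∈ I, star x ∈ I) {J : Type*} {F : Filter J} [F.NeBot] {e : J → A}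
    (he : ∀ j, e j ∈ relClosure ι I) {M : ℝ} (hM : ∀ j, ‖e j‖ ≤ M)
    (heI : ∀ x ∈ relClosure ι I, Tendsto (fun j => e j * x) F (𝓝 x)) : relClosure ι I ≤ I := by
  intro x hx
  obtain ⟨N, hN0, hN⟩ : ∃ N, 0 ≤ N ∧ ∀ a : A, ‖star a‖ ≤ N * ‖a‖ := by
    let S : A →L[ℝ] A := (starAddEquiv (R := A)).toAddMonoidHom.toRealLinearMap hstar
    exact ⟨‖S‖, norm_nonneg _, fun a => S.le_opNorm a⟩
  have hj : ∀ n : ℕ, ∃ j, ‖e j * x - x‖ ≤ 1 / ((n : ℝ) + 1) := fun n =>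
    ((tendsto_iff_norm_sub_tendsto_zero.1 (heI x hx)).eventually
      (eventually_le_nhds (by positivity))).exists
  choose j hj using hj
  have hM0 : 0 ≤ M := (norm_nonneg _).trans (hM (j 0))
  set E : ℕ → A := fun n => e (j n) + star (e (j n)) - star (e (j n)) * e (j n) with hE
  have hEs : ∀ n, IsSelfAdjoint (E n) := fun n =>
    (IsSelfAdjoint.add_star_self _).sub (.star_mul_self _)
  have hst : ∀ n, ‖star (e (j n))‖ ≤ N * M := fun n => (hN _).trans (by gcongr; exact hM _)
  have hEM : ∀ n, ‖E n‖ ≤ M + N * M + N * M * M := fun n => by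
    refine (norm_sub_le _ _).trans (add_le_add ((norm_add_le _ _).trans
      (add_le_add (hM _) (hst n))) ((norm_mul_le _ _).trans ?_))
    exact mul_le_mul (hst n) (hM _) (norm_nonneg _) (by positivity)
  have hEI : ∀ n, E n ∈ relClosure ι I := fun n =>
    Submodule.sub_mem _ (Submodule.add_mem _ (he _) (star_mem_relClosure hIs (he _)))
      (relClosure_mul_mem hI2 _ _ (he _)).1
  have hEx : Tendsto (fun n => E n * x) atTop (𝓝 x) := by
    rw [tendsto_iff_norm_sub_tendsto_zero]
    have h1 : Tendsto (fun n : ℕ => (‖(1 : A)‖ + N * M) * (1 / ((n : ℝ) + 1))) atTop (𝓝 0) := by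
      simpa using tendsto_one_div_add_atTop_nhds_zero_nat.const_mul (‖(1 : A)‖ + N * M)
    refine squeeze_zero (fun _ => norm_nonneg _) (fun n => ?_) h1
    have h2 : E n * x - x = (1 - star (e (j n))) * (e (j n) * x - x) := by
      simp only [hE]; noncomm_ring
    rw [h2]
    refine (norm_mul_le _ _).trans (mul_le_mul ?_ (hj n) (norm_nonneg _) (by positivity))
    exact (norm_sub_le _ _).trans (by gcongr; exact hst n)
  obtain ⟨φ, g, hg⟩ := exists_isFourierPlateau hγ hγ1 0 (r := 1 / 4) (R := 1 / 2) (by norm_num)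
    (by norm_num)
  have hlim := hg.tendsto_fourierCalc_mul hA hEs hEM hEx
  rw [hg.eq_zero 1 (by norm_num), Complex.ofReal_zero, zero_smul] at hlim
  have h1 := hlim.const_sub x
  rw [sub_zero] at h1
  refine hI.mem_of_tendsto h1 (.of_forall fun n => ?_)
  have h2 := hg.one_sub_fourierCalc_mem (by norm_num) hA hι hinj hI hI2 hIs (hEs n) (hEI n)
  have h3 := (hI2 x _ h2).2
  rwa [sub_mul, one_mul] at h3

end RelClosure

section StarAlgebra

open Polynomial

lemma aeval_mul_of_mul_eq_smul {D : Type*} [Ring D] [Algebra ℂ D] {h y : D} {c : ℂ}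
    (hy : h * y = c • y) (G : ℂ[X]) : aeval h G * y = G.eval c • y := by
  obtain ⟨Q, hQ⟩ := X_sub_C_dvd_sub_C_eval (a := c) (p := G)
  have h1 : G = Q * (X - C c) + C (G.eval c) := by rw [mul_comm, ← hQ, sub_add_cancel]
  have h2 : aeval h (X - C c) * y = 0 := by
    rw [map_sub, aeval_X, aeval_C, sub_mul, hy, ← Algebra.smul_def, sub_self]
  conv_lhs => rw [h1]
  rw [map_add, map_mul, add_mul, mul_assoc, h2, mul_zero, zero_add, aeval_C, ← Algebra.smul_def]

variable {D : Type*} [Ring D] [Algebra ℂ D] [StarRing D] [StarModule ℂ D]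

lemma isSelfAdjoint_aeval_prod_X_sub_C {h : D} (hh : IsSelfAdjoint h) (s : Finset ℝ) :
    IsSelfAdjoint (aeval h (∏ i ∈ s, (X - C (i : ℂ)))) := by
  classical
  induction s using Finset.induction_on with
  | empty => simp
  | insert i s hi ih =>
    rw [Finset.prod_insert hi, map_mul]
    refine (IsSelfAdjoint.commute_iff ?_ ih).1 ((Commute.all _ _).map (aeval h))
    rw [map_sub, aeval_X, aeval_C]
    refine hh.sub ?_
    rw [IsSelfAdjoint, ← algebraMap_star_comm]
    simp

/-- A projection `p` whose corner consists of the multiples of `p`. -/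
structure IsMinimalProjection (p : D) : Prop extends IsStarProjection p where
  corner : ∀ x, ∃ c : ℂ, p * x * p = c • p

lemma exists_isStarProjection_lt
    (hpoly : ∀ d : D, IsSelfAdjoint d → ∃ s : Finset ℝ, aeval d (∏ i ∈ s, (X - C (i : ℂ))) = 0)
    {p : D} (hp : IsStarProjection p) (hmin : ¬ IsMinimalProjection p) :
    ∃ e, IsStarProjection e ∧ p * e = e ∧ e * p = e ∧ e ≠ 0 ∧ e ≠ p := by
  classical
  have hpp : p * p = p := hp.isIdempotentElem
  obtain ⟨x, hx⟩ : ∃ x, ∀ c : ℂ, p * x * p ≠ c • p := by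
    by_contra! hcon
    exact hmin ⟨hp, hcon⟩
  obtain ⟨x, hxs, hx⟩ : ∃ x, IsSelfAdjoint x ∧ ∀ c : ℂ, p * x * p ≠ c • p := by
    by_contra! hcon
    obtain ⟨a, ha⟩ := hcon _ (realPart x).2
    obtain ⟨b, hb⟩ := hcon _ (imaginaryPart x).2
    refine hx (a + Complex.I * b) ?_
    conv_lhs => rw [← realPart_add_I_smul_imaginaryPart x]
    rw [mul_add, add_mul, ha, mul_smul_comm, smul_mul_assoc, hb, add_smul, smul_smul]
  set h := p * x * p with hh
  have hhs : IsSelfAdjoint h := by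
    rw [IsSelfAdjoint, hh]
    simp [hp.isSelfAdjoint.star_eq, hxs.star_eq, mul_assoc]
  have hph : p * h = h := by simp only [hh, ← mul_assoc, hpp]
  have hhp : h * p = h := by simp only [hh, mul_assoc, hpp]
  have hcomm : Commute h p := hhp.trans hph.symm
  have hcG : ∀ G : ℂ[X], Commute p (aeval h G) := fun G => by
    induction G using Polynomial.induction_on' with
    | add G Q hG hQ => rw [map_add]; exact hG.add_right hQ
    | monomial n a =>
      rw [aeval_monomial]
      exact (Algebra.commute_algebraMap_right a p).mul_right (hcomm.symm.pow_right n)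
  obtain ⟨s, hs⟩ := hpoly h hhs
  obtain ⟨t, ht, htmin⟩ := Finset.exists_min_image
    (s.powerset.filter fun t : Finset ℝ => aeval h (∏ i ∈ t, (X - C (i : ℂ))) * p = 0) Finset.card
    ⟨s, by simp [hs]⟩
  simp only [Finset.mem_filter, Finset.mem_powerset] at ht htmin
  have hp0 : p ≠ 0 := fun h0 => hx 0 (by simp [hh, h0])
  have htne : t.Nonempty := by
    rw [Finset.nonempty_iff_ne_empty]
    rintro rfl
    exact hp0 (by simpa using ht.2)
  obtain ⟨l, hl⟩ := htne
  set G : ℂ[X] := ∏ i ∈ t.erase l, (X - C (i : ℂ)) with hG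
  set y := aeval h G * p with hy
  have hy0 : y ≠ 0 := fun h0 => by
    have := htmin (t.erase l) ⟨(Finset.erase_subset _ _).trans ht.1, h0⟩
    have := Finset.card_erase_lt_of_mem hl
    omega
  have hhy : h * y = (l : ℂ) • y := by
    have h1 := ht.2
    rw [← Finset.mul_prod_erase t _ hl, map_mul, mul_assoc, ← hG, ← hy, map_sub, aeval_X, aeval_C,
      sub_mul, ← Algebra.smul_def, sub_eq_zero] at h1
    exact h1
  have hGl : G.eval (l : ℂ) ≠ 0 := by
    rw [hG, eval_prod, Finset.prod_ne_zero_iff]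
    intro i hi
    simpa [sub_eq_zero] using (Finset.ne_of_mem_erase hi).symm
  have hGr : G.eval (l : ℂ) = ((∏ i ∈ t.erase l, (l - i) : ℝ) : ℂ) := by
    rw [hG, eval_prod]; simp
  have hpy : p * y = y := by rw [hy, ← mul_assoc, (hcG G).eq, mul_assoc, hpp]
  have hyp : y * p = y := by rw [hy, mul_assoc, hpp]
  have hys : IsSelfAdjoint y :=
    ((isSelfAdjoint_aeval_prod_X_sub_C hhs _).commute_iff hp.isSelfAdjoint).1 (hcG G).symm
  have hyy : y * y = G.eval (l : ℂ) • y := by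
    conv_lhs => rw [hy]
    rw [mul_assoc, hpy, aeval_mul_of_mul_eq_smul hhy]
  set a := G.eval (l : ℂ)
  refine ⟨a⁻¹ • y, ⟨?_, ?_⟩, ?_, ?_, ?_, ?_⟩
  · rw [IsIdempotentElem, smul_mul_smul_comm, hyy, smul_smul, mul_assoc, inv_mul_cancel₀ hGl,
      mul_one]
  · rw [IsSelfAdjoint, star_smul, hys.star_eq, hGr]
    simp
  · rw [mul_smul_comm, hpy]
  · rw [smul_mul_assoc, hyp]
  · exact smul_ne_zero (inv_ne_zero hGl) hy0
  · intro he
    refine hx l ?_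
    rw [← he, smul_comm, ← hhy, ← mul_smul_comm, he, hhp]

/-- Induction over projections: it suffices to treat the minimal ones and orthogonal sums. -/
lemma IsStarProjection.induction_on_minimal
    (hpoly : ∀ d : D, IsSelfAdjoint d → ∃ s : Finset ℝ, aeval d (∏ i ∈ s, (X - C (i : ℂ))) = 0)
    (hseq : ∀ p : ℕ → D, (∀ n, IsStarProjection (p n)) → (∀ n m, n ≠ m → p n * p m = 0) →
      ∃ n, p n = 0) {P : D → Prop} (hmin : ∀ p, IsMinimalProjection p → P p)
    (hadd : ∀ p q, IsStarProjection p → IsStarProjection q → P p → P q → P (p + q))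
    {p : D} (hp : IsStarProjection p) : P p := by
  by_contra hcon
  let S := {p : D // IsStarProjection p ∧ ¬ P p}
  have hstep : ∀ p : S, ∃ q : S, p.1 * q.1 = q.1 ∧ q.1 * p.1 = q.1 ∧ q.1 ≠ p.1 := by
    rintro ⟨p, hp, hPp⟩
    obtain ⟨e, he, hpe, hep, he0, hne⟩ := exists_isStarProjection_lt hpoly hp
      fun h => hPp (hmin p h)
    have hpp : p * p = p := hp.isIdempotentElem
    have hee : e * e = e := he.isIdempotentElem
    have hr : IsStarProjection (p - e) :=
      ⟨by rw [IsIdempotentElem, mul_sub, sub_mul, sub_mul, hpp, hep, hpe, hee, sub_self, sub_zero],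
        hp.isSelfAdjoint.sub he.isSelfAdjoint⟩
    by_cases hPe : P e
    · refine ⟨⟨p - e, hr, fun hP => hPp ?_⟩, ?_, ?_, fun h => he0 (by simpa using h)⟩
      · simpa using hadd _ _ hr he hP hPe
      · simp only [mul_sub, hpp, hpe]
      · simp only [sub_mul, hpp, hep]
    · exact ⟨⟨e, he, hPe⟩, hpe, hep, hne⟩
  choose f hf1 hf2 hf3 using hstep
  let u : ℕ → S := fun n => f^[n] ⟨p, hp, hcon⟩
  have hu : ∀ n, u (n + 1) = f (u n) := fun n => Function.iterate_succ_apply' f n _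
  have hidem : ∀ n, (u n).1 * (u n).1 = (u n).1 := fun n => (u n).2.1.isIdempotentElem
  have hle : ∀ n m, n ≤ m → (u n).1 * (u m).1 = (u m).1 ∧ (u m).1 * (u n).1 = (u m).1 := by
    intro n m hnm
    induction m, hnm using Nat.le_induction with
    | base => exact ⟨hidem n, hidem n⟩
    | succ m hm ih =>
      rw [hu]
      constructor
      · rw [← hf1 (u m), ← mul_assoc, ih.1]
      · rw [← hf2 (u m), mul_assoc, ih.2]
  obtain ⟨n, hn⟩ := hseq (fun n => (u n).1 - (u (n + 1)).1)
    (fun n => ⟨by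
      rw [IsIdempotentElem, mul_sub, sub_mul, sub_mul, hidem, hidem, (hle n _ n.le_succ).1,
        (hle n _ n.le_succ).2, sub_self, sub_zero],
      (u n).2.1.isSelfAdjoint.sub (u (n + 1)).2.1.isSelfAdjoint⟩)
    (fun n m hnm => by
      rcases lt_or_gt_of_ne hnm with hlt | hlt
      · rw [mul_sub, sub_mul, sub_mul, (hle n m (by omega)).1, (hle (n + 1) m (by omega)).1,
          (hle n (m + 1) (by omega)).1, (hle (n + 1) (m + 1) (by omega)).1]
        simp
      · rw [mul_sub, sub_mul, sub_mul, (hle m n (by omega)).2, (hle m (n + 1) (by omega)).2,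
          (hle (m + 1) n (by omega)).2, (hle (m + 1) (n + 1) (by omega)).2]
        simp)
  exact hf3 (u n) (by rw [← hu]; exact (sub_eq_zero.1 hn).symm)

lemma finiteDimensional_of_aeval_prod_eq_zero
    (hpoly : ∀ d : D, IsSelfAdjoint d → ∃ s : Finset ℝ, aeval d (∏ i ∈ s, (X - C (i : ℂ))) = 0)
    (hpos : ∀ x : D, star x * x = 0 → x = 0)
    (hseq : ∀ p : ℕ → D, (∀ n, IsStarProjection (p n)) → (∀ n m, n ≠ m → p n * p m = 0) →
      ∃ n, p n = 0) : FiniteDimensional ℂ D := by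
  let V : D → D → Submodule ℂ D := fun p q => LinearMap.range (LinearMap.mulLeftRight ℂ (p, q))
  have hV : ∀ p q x, p * x * q ∈ V p q := fun p q x => ⟨x, by simp⟩
  have hminmin : ∀ p q, IsMinimalProjection p → IsMinimalProjection q →
      FiniteDimensional ℂ (V p q) := by
    intro p q hp hq
    have hpp : p * p = p := hp.isIdempotentElem
    have hqq : q * q = q := hq.isIdempotentElem
    by_cases hzero : ∀ x, p * x * q = 0
    · have : V p q = ⊥ := by
        rw [eq_bot_iff]
        rintro _ ⟨x, rfl⟩
        simpa using hzero x
      rw [this]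
      infer_instance
    · push Not at hzero
      obtain ⟨x, hx⟩ := hzero
      set z := p * x * q with hz
      have hpz : p * z = z := by simp only [hz, ← mul_assoc, hpp]
      have hzq : z * q = z := by simp only [hz, mul_assoc, hqq]
      have hqz : q * star z = star z := by
        rw [← hq.isSelfAdjoint.star_eq, ← star_mul, hzq]
      obtain ⟨c, hc⟩ := hp.corner (z * star z)
      have hc' : z * star z = c • p := by
        have h1 : star z * p = star z := by
          rw [← hp.isSelfAdjoint.star_eq, ← star_mul, hpz]
        rw [← hc, ← mul_assoc, hpz, mul_assoc z, h1]
      have hc0 : c ≠ 0 := fun h0 => by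
        rw [h0, zero_smul] at hc'
        have := hpos (star z) (by rwa [star_star])
        exact hx (star_eq_zero.1 this)
      refine Submodule.finiteDimensional_of_le (S₂ := ℂ ∙ z) ?_
      rintro _ ⟨y, rfl⟩
      obtain ⟨d, hd⟩ := hq.corner (star z * p * y)
      rw [Submodule.mem_span_singleton]
      refine ⟨c⁻¹ * d, ?_⟩
      have h1 : c • (p * y * q) = d • z := by
        have h2 : q * (star z * p * y) * q = star z * (p * y * q) := by
          simp only [← mul_assoc, hqz]
        calc c • (p * y * q) = (c • p) * (p * y * q) := by
              rw [smul_mul_assoc]; simp only [← mul_assoc, hpp]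
          _ = z * (star z * (p * y * q)) := by rw [← hc', mul_assoc]
          _ = z * (d • q) := by rw [← h2, hd]
          _ = d • z := by rw [mul_smul_comm, hzq]
      rw [mul_smul, ← h1, smul_smul, inv_mul_cancel₀ hc0, one_smul]
      simp
  have hminall : ∀ p q, IsMinimalProjection p → IsStarProjection q →
      FiniteDimensional ℂ (V p q) := by
    intro p q hp hq
    refine hq.induction_on_minimal hpoly hseq (P := fun q => FiniteDimensional ℂ (V p q))
      (fun q hq => hminmin p q hp hq) fun q r _ _ h1 h2 => ?_
    refine Submodule.finiteDimensional_of_le (S₂ := V p q ⊔ V p r) ?_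
    rintro _ ⟨x, rfl⟩
    rw [LinearMap.mulLeftRight_apply, mul_add]
    exact Submodule.add_mem_sup (hV _ _ _) (hV _ _ _)
  have hall : FiniteDimensional ℂ (V 1 1) := by
    refine (IsStarProjection.one D).induction_on_minimal hpoly hseq
      (P := fun p => FiniteDimensional ℂ (V p 1)) (fun p hp => hminall p 1 hp (.one D))
      fun q r _ _ h1 h2 => ?_
    refine Submodule.finiteDimensional_of_le (S₂ := V q 1 ⊔ V r 1) ?_
    rintro _ ⟨x, rfl⟩
    rw [LinearMap.mulLeftRight_apply, add_mul, add_mul]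
    exact Submodule.add_mem_sup (hV _ _ _) (hV _ _ _)
  have htop : V 1 1 = ⊤ := eq_top_iff.2 fun x _ => by simpa using hV 1 1 x
  exact Module.Finite.of_surjective (V 1 1).subtype fun x => ⟨⟨x, htop ▸ trivial⟩, rfl⟩

end StarAlgebra

section FiniteCodimension

variable {A : Type*} [NormedRing A] [StarRing A] [NormedAlgebra ℂ A] [CompleteSpace A]
  [StarModule ℂ A] {I : Submodule ℂ A}

/-- A sequence of self-adjoint elements that are pairwise orthogonal idempotents modulo a closed
ideal has a common self-adjoint element acting on them by positive scalars tending to zero. -/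
lemma exists_isSelfAdjoint_mul_sub_smul_mem (hstar : Continuous (star : A → A))
    (hI : IsClosed (I : Set A)) {P : ℕ → A} (hP : ∀ n, IsSelfAdjoint (P n))
    (hidem : ∀ n, P n * P n - P n ∈ I) (horth : ∀ n m, n ≠ m → P n * P m ∈ I) :
    ∃ h : A, IsSelfAdjoint h ∧ ∃ c : ℕ → ℝ, (∀ n, 0 < c n) ∧ Tendsto c atTop (𝓝 0) ∧
      ∀ m, h * P m - (c m : ℂ) • P m ∈ I := by
  have : ContinuousStar A := ⟨hstar⟩
  set c : ℕ → ℝ := fun n => (1 / 2) ^ n / (‖P n‖ + 1) with hc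
  have hc0 : ∀ n, 0 < c n := fun n => by positivity
  have hgeo : Summable fun n : ℕ => (1 / 2 : ℝ) ^ n := summable_geometric_two
  have hsum : Summable fun n => (c n : ℂ) • P n := by
    refine Summable.of_norm_bounded hgeo fun n => ?_
    rw [norm_smul, Complex.norm_real, Real.norm_of_nonneg (hc0 n).le, hc, div_mul_eq_mul_div,
      div_le_iff₀ (by positivity)]
    gcongr
    linarith
  refine ⟨∑' n, (c n : ℂ) • P n, ?_, c, hc0, ?_, fun m => ?_⟩
  · rw [IsSelfAdjoint, tsum_star]
    simp [(hP _).star_eq]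
  · refine squeeze_zero (fun n => (hc0 n).le) (fun n => ?_) hgeo.tendsto_atTop_zero
    exact div_le_self (by positivity) (by linarith [norm_nonneg (P n)])
  · have h1 := (hsum.hasSum.mul_right (P m)).sub
      (hasSum_ite_eq m ((c m : ℂ) • P m))
    refine hI.mem_of_tendsto h1 (.of_forall fun s => I.sum_mem fun n _ => ?_)
    split_ifs with hn
    · rw [hn, smul_mul_assoc, ← smul_sub]
      exact I.smul_mem _ (hidem m)
    · rw [sub_zero, smul_mul_assoc]
      exact I.smul_mem _ (horth n m hn)

open Polynomial in
lemma finiteDimensional_quotient_of_aeval_mem (hstar : Continuous (star : A → A))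
    (hI : IsClosed (I : Set A)) (hI2 : ∀ a x : A, x ∈ I → a * x ∈ I ∧ x * a ∈ I)
    (hIs : ∀ x ∈ I, star x ∈ I) (hpos : ∀ x : A, star x * x ∈ I → x ∈ I)
    (hpoly : ∀ h : A, IsSelfAdjoint h → ∃ s : Finset ℝ,
      aeval h (∏ i ∈ s, (X - C (i : ℂ))) ∈ I) : FiniteDimensional ℂ (A ⧸ I) := by
  let J : Ideal A := { I with smul_mem' := fun a x hx => (hI2 a x hx).1 }
  have : J.IsTwoSided := ⟨fun {x} b hx => (hI2 b x hx).2⟩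
  let D := A ⧸ J
  let π : A →ₐ[ℂ] D := Ideal.Quotient.mkₐ ℂ J
  have hπ : Function.Surjective π := Ideal.Quotient.mkₐ_surjective ℂ J
  have hπ0 : ∀ a, π a = 0 ↔ a ∈ I := fun a => Ideal.Quotient.eq_zero_iff_mem
  have hπe : ∀ a b, π a = π b ↔ a - b ∈ I := fun a b => by
    rw [← hπ0, map_sub, sub_eq_zero]
  let st : D → D := fun d => π (star (Function.surjInv hπ d))
  have hst : ∀ a, st (π a) = π (star a) := fun a => by
    rw [hπe, ← star_sub]
    exact hIs _ ((hπe _ _).1 (Function.surjInv_eq hπ _))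
  let _ : StarRing D :=
    { star := st
      star_involutive := hπ.forall.2 fun a =>
        ((congrArg st (hst a)).trans (hst _)).trans (by rw [star_star])
      star_mul := hπ.forall₂.2 fun a b => by
        rw [← map_mul, hst, hst, hst, star_mul, map_mul]
      star_add := hπ.forall₂.2 fun a b => by
        rw [← map_add, hst, hst, hst, star_add, map_add] }
  have hstar' : ∀ a, star (π a) = π (star a) := hst
  have : StarModule ℂ D := ⟨fun c => hπ.forall.2 fun a => by
    rw [← map_smul, hstar', hstar', star_smul, map_smul]⟩
  have hlift : ∀ d : D, IsSelfAdjoint d → ∃ a, IsSelfAdjoint a ∧ π a = d := fun d hd => by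
    obtain ⟨a, rfl⟩ := hπ d
    refine ⟨(1 / 2 : ℂ) • (a + star a), ?_, ?_⟩
    · rw [IsSelfAdjoint, star_smul, star_add, star_star, add_comm]
      simp
    · rw [map_smul, map_add, ← hstar', hd.star_eq, ← two_smul ℂ, smul_smul]
      norm_num
  have hfin : FiniteDimensional ℂ D := by
    refine finiteDimensional_of_aeval_prod_eq_zero (fun d hd => ?_) (hπ.forall.2 fun x hx => ?_)
      fun p hp horth => ?_
    · obtain ⟨a, ha, rfl⟩ := hlift d hd
      obtain ⟨s, hs⟩ := hpoly a ha
      exact ⟨s, by rw [aeval_algHom_apply, hπ0]; exact hs⟩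
    · rw [hstar', ← map_mul, hπ0] at hx
      exact (hπ0 x).2 (hpos x hx)
    · by_contra! hne
      choose P hPs hPp using fun n => hlift (p n) (hp n).isSelfAdjoint
      obtain ⟨h, hh, c, hc0, hclim, hmem⟩ := exists_isSelfAdjoint_mul_sub_smul_mem hstar hI hPs
        (fun n => by
          rw [← hπe, map_mul, hPp]
          exact (hp n).isIdempotentElem)
        (fun n m hnm => by rw [← hπ0, map_mul, hPp, hPp, horth n m hnm])
      obtain ⟨s, hs⟩ := hpoly h hh
      have hcs : ∀ n, c n ∈ s.filter (0 < ·) := fun n => by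
        have h1 : π h * p n = (c n : ℂ) • p n := by
          rw [← hPp, ← map_mul, ← map_smul, hπe]
          exact hmem n
        have h2 := aeval_mul_of_mul_eq_smul h1 (∏ i ∈ s, (X - C (i : ℂ)))
        rw [aeval_algHom_apply, (hπ0 _).2 hs, zero_mul, eq_comm, smul_eq_zero_iff_left (hne n),
          eval_prod, Finset.prod_eq_zero_iff] at h2
        obtain ⟨i, hi, h2⟩ := h2
        have h3 : c n = i := by simpa [sub_eq_zero] using h2
        rw [Finset.mem_filter, h3]
        exact ⟨hi, h3 ▸ hc0 n⟩
      have h0 := (s.filter (0 < ·)).finite_toSet.isClosed.mem_of_tendsto hclim (.of_forall hcs)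
      simp at h0
  have hker : LinearMap.ker π.toLinearMap = I := by
    ext a
    exact hπ0 a
  exact Module.Finite.equiv ((Submodule.quotEquivOfEq _ _ hker).symm.trans
    (LinearMap.quotKerEquivOfSurjective π.toLinearMap hπ)).symm

end FiniteCodimension

section Main

lemma continuous_of_intertwining.{u, v, w} {A : Type u} {B : Type v} {X : Type w}
    [NormedRing A] [StarRing A] [NormedAlgebra ℂ A] [CompleteSpace A] [StarModule ℂ A]
    [CStarAlgebra B] (hstar : Continuous (star : A → A)) {ι : A →⋆ₙₐ[ℂ] B}
    (hinj : Function.Injective ι) (hι : Continuous ι) {γ : ℝ} (hγ : 0 < γ) (hγ1 : γ < 1)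
    (hA : HasExpGrowth A γ)
    (hblai : ∀ I : Submodule ℂ A, IsClosed (I : Set A) →
      (∀ (a x : A), x ∈ I → a * x ∈ I ∧ x * a ∈ I) →
      (∀ x ∈ I, star x ∈ I) →
      FiniteDimensional ℂ (A ⧸ I) →
      ∃ (J : Type u) (F : Filter J) (e : J → A), F.NeBot ∧ (∀ j, e j ∈ I) ∧
        (∃ M : ℝ, ∀ j, ‖e j‖ ≤ M) ∧
        ∀ x ∈ I, Filter.Tendsto (fun j => e j * x) F (nhds x))
    [NormedAddCommGroup X] [NormedSpace ℂ X] [CompleteSpace X]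
    {L : A →ₗ[ℂ] X →ₗ[ℂ] X} (hL : ∀ (a b : A) (x : X), L (a * b) x = L a (L b x))
    {K : ℝ} (hK : 0 ≤ K) (hLK : ∀ (a : A) (x : X), ‖L a x‖ ≤ K * ‖a‖ * ‖x‖)
    {θ : A →ₗ[ℂ] X} (hθ : ∀ a : A, Continuous fun b : A => θ (a * b) - L a (θ b)) :
    Continuous θ := by
  let T := continuityIdeal L θ
  have hT2 : ∀ a x : A, x ∈ T → a * x ∈ T ∧ x * a ∈ T := continuityIdeal_mul_mem hL hLK hθ
  have hTc : IsClosed (T : Set A) := isClosed_continuityIdeal hLK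
  let I : Submodule ℂ A :=
    { carrier := {x | x ∈ T ∧ star x ∈ T}
      add_mem' := fun hx hy => ⟨T.add_mem hx.1 hy.1, by
        rw [star_add]; exact T.add_mem hx.2 hy.2⟩
      zero_mem' := ⟨T.zero_mem, by rw [star_zero]; exact T.zero_mem⟩
      smul_mem' := fun c x hx => ⟨T.smul_mem c hx.1, by
        rw [star_smul]; exact T.smul_mem _ hx.2⟩ }
  have hI : IsClosed (I : Set A) := hTc.inter (hTc.preimage hstar)
  have hI2 : ∀ a x : A, x ∈ I → a * x ∈ I ∧ x * a ∈ I := fun a x hx =>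
    ⟨⟨(hT2 a x hx.1).1, by rw [star_mul]; exact (hT2 _ _ hx.2).2⟩,
      (hT2 a x hx.1).2, by rw [star_mul]; exact (hT2 _ _ hx.2).1⟩
  have hIs : ∀ x ∈ I, star x ∈ I := fun x hx => ⟨hx.2, by rw [star_star]; exact hx.1⟩
  have horth : ∀ a : ℕ → A, (∀ n, IsSelfAdjoint (a n)) → (∀ n m, n ≠ m → a n * a m = 0) →
      ∃ n, a n * a n ∈ I := fun a ha hnm => by
    obtain ⟨n, hn⟩ := exists_mul_self_mem_continuityIdeal hK hLK hθ hnm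
    exact ⟨n, hn, by rw [star_mul, (ha n).star_eq]; exact hn⟩
  have hcl : IsClosed (relClosure ι I : Set A) := isClosed_relClosure hι
  have hfin : FiniteDimensional ℂ (A ⧸ relClosure ι I) :=
    finiteDimensional_quotient_of_aeval_mem hstar hcl (relClosure_mul_mem hI2)
      (fun x => star_mem_relClosure hIs)
      (fun x => mem_relClosure_of_star_mul_self hγ hγ1 hA hι hinj hI hI2 hIs)
      fun h hh => exists_aeval_mem_relClosure hγ hγ1 hA hι hinj hI2 horth hh
  obtain ⟨J, F, e, hF, he, ⟨M, hM⟩, heI⟩ := hblai _ hcl (relClosure_mul_mem hI2)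
    (fun x => star_mem_relClosure hIs) hfin
  have hle := relClosure_le_of_approximate_identity hstar hγ hγ1 hA hι hinj hI hI2 hIs he hM heI
  exact continuous_of_le_continuityIdeal hθ hcl (fun x hx => (hle hx).1) hfin he hM heI

end Main

/-- Let `A` be a `(k,p,q)`-differential subalgebra in which every closed
two-sided `*`-ideal of finite codimension has a bounded left approximate identity.  Then every
`A`-intertwining operator `θ : A → X` into a Banach `A`-bimodule `X` is continuous. -/
theorem stmt16.{u}
    {A : Type u} {B : Type*}
    [NormedRing A] [StarRing A] [NormedAlgebra ℂ A] [CompleteSpace A]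
    [NonUnitalNormedRing B] [StarRing B] [CStarRing B] [NormedSpace ℂ B]
    [IsScalarTower ℂ B B] [SMulCommClass ℂ B B] [StarModule ℂ B] [CompleteSpace B]
    (hstar : Continuous (star : A → A))
    (ι : A →⋆ₙₐ[ℂ] B) (hinj : Function.Injective ι) (hcont : Continuous ι)
    (k : ℕ) (hk : 2 ≤ k) (p q : ℝ) (hp : 0 < p) (hq : 0 < q) (hpq : p + q = (k : ℝ))
    (C : ℝ) (hC : 0 < C)
    (hdiff : ∀ a : A, ‖a ^ k‖ ≤ C * ‖a‖ ^ p * ‖ι a‖ ^ q)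
    -- every closed two-sided `*`-ideal of finite codimension has a bounded
    -- left approximate identity:
    (hblai : ∀ I : Submodule ℂ A, IsClosed (I : Set A) →
      (∀ (a x : A), x ∈ I → a * x ∈ I ∧ x * a ∈ I) →
      (∀ x ∈ I, star x ∈ I) →
      FiniteDimensional ℂ (A ⧸ I) →
      ∃ (J : Type u) (F : Filter J) (e : J → A), F.NeBot ∧ (∀ j, e j ∈ I) ∧
        (∃ M : ℝ, ∀ j, ‖e j‖ ≤ M) ∧
        ∀ x ∈ I, Filter.Tendsto (fun j => e j * x) F (nhds x))
    -- `X` a Banach `A`-bimodule: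
    {X : Type*} [NormedAddCommGroup X] [NormedSpace ℂ X] [CompleteSpace X]
    (L : A →ₗ[ℂ] X →ₗ[ℂ] X) (R : X →ₗ[ℂ] A →ₗ[ℂ] X)
    (hL : ∀ (a b : A) (x : X), L (a * b) x = L a (L b x))
    (hR : ∀ (x : X) (a b : A), R x (a * b) = R (R x a) b)
    (hLR : ∀ (a : A) (x : X) (b : A), R (L a x) b = L a (R x b))
    (hXbdd : ∃ K : ℝ, 0 < K ∧ ∀ (a : A) (x : X),
      ‖L a x‖ ≤ K * ‖a‖ * ‖x‖ ∧ ‖R x a‖ ≤ K * ‖x‖ * ‖a‖)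
    -- `θ : A → X` an `A`-intertwining operator (with `A` a bimodule over itself):
    (θ : A →ₗ[ℂ] X)
    (hθ : ∀ a : A, Continuous (fun b : A => θ (a * b) - L a (θ b)) ∧
      Continuous (fun b : A => θ (b * a) - R (θ b) a)) :
    Continuous θ := by
  let _ : NonUnitalCStarAlgebra B := { }
  let ι' : A →⋆ₙₐ[ℂ] Unitization ℂ B := (Unitization.inrNonUnitalStarAlgHom ℂ B).comp ι
  have hι' : ∀ a, ‖ι' a‖ = ‖ι a‖ := fun a => Unitization.norm_inr (𝕜 := ℂ) (ι a)
  have hinj' : Function.Injective ι' := Unitization.inr_injective.comp hinj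
  have hcont' : Continuous ι' := (Unitization.isometry_inr (𝕜 := ℂ)).continuous.comp hcont
  have : StarModule ℂ A := ⟨fun c a => hinj (by simp only [map_star, map_smul, star_smul])⟩
  obtain ⟨γ, hγ, hγ1, hA⟩ := hasExpGrowth_of_differential hcont' hk hp hq hpq
    (C := C) (fun a => by rw [hι']; exact hdiff a)
  obtain ⟨K, hK, hLK⟩ := hXbdd
  exact continuous_of_intertwining hstar hinj' hcont' hγ hγ1 hA hblai hL hK.le
    (fun a x => (hLK a x).1) fun a => (hθ a).1
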